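/- Let K and A be finite sets with |K| ≥ 2, let d_A, d_B, d_E ∈ ℕ, let Θ be a quantum channel (completely positive trace-preserving linear map) from d_A×d_A complex matrices to (d_B·d_E)×(d_B·d_E) complex matrices (the output space ℂ^{d_B} ⊗ ℂ^{d_E} shared by Bob and Eve), and let ξ : A → density matrices on ℂ^{d_A}. Put Θ_B = Tr_E ∘ Θ and Θ_E = Tr_B ∘ Θ (partial traces over Eve's and Bob's factors). Assume C(Θ_B ∘ ξ) > C₁(Θ_E ∘ ξ), where C(Θ_B ∘ ξ) = max over probability distributions P on A of the Holevo quantity χ(P, Θ_B ∘ ξ), and C₁(Θ_E ∘ ξ) = max over probability distributions P on A and POVMs M on ℂ^{d_E} of the Shannon mutual information between input a ~ P and the outcome of measuring Θ_E(ξ(a)) with M. Fix a finite set E. Then for every α, β ∈ (0,1) and every sufficiently large n ∈ ℕ there exist a random coder F_A from K to Aⁿ and a POVM M_B on (ℂ^{d_B})^{⊗n} with outcomes in K such that for every Eve observable M_E on (ℂ^{d_E})^{⊗n} of the factorized-with-postprocessing form M_E(k) = Σ_{eⁿ ∈ f⁻¹(k)} M₁(e₁) ⊗ ⋯ ⊗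 M_n(e_n) (each M_i a POVM on ℂ^{d_E} with outcomes in E, and f : Eⁿ → K an arbitrary function), the random variables K_A (uniform on K) and (K_B, K_E) — obtained by sampling aⁿ = (a₁,…,a_n) from F_A(K_A), forming the state Θ^{⊗n}(ξ(a₁) ⊗ ⋯ ⊗ ξ(a_n)), and measuring M_B on Bob's n subsystems and M_E on Eve's n subsystems — satisfy: (1) Pr[K_A = K_B] ≥ α, and (2) I(K_A; K_E) ≤ 1 − β. -/

import Mathlib

open scoped BigOperators ComplexOrder

noncomputable section

namespace QKD

/-- A probability distribution on a finite type. -/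
def IsProbDist {α : Type*} [Fintype α] (P : α → ℝ) : Prop :=
  (∀ a, 0 ≤ P a) ∧ ∑ a, P a = 1

/-- A classical channel (stochastic matrix) from `α` to `β`. -/
def IsChannel {α β : Type*} [Fintype α] [Fintype β] (V : α → β → ℝ) : Prop :=
  (∀ a b, 0 ≤ V a b) ∧ ∀ a, ∑ b, V a b = 1

/-- Shannon entropy, in bits. -/
def entropy {α : Type*} [Fintype α] (P : α → ℝ) : ℝ :=
  (∑ a, Real.negMulLog (P a)) / Real.log 2

/-- Shannon mutual information (in bits) of a joint distribution on `α × β`. -/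
def miJoint {α β : Type*} [Fintype α] [Fintype β] (J : α → β → ℝ) : ℝ :=
  entropy (fun a => ∑ b, J a b) + entropy (fun b => ∑ a, J a b)
    - entropy (fun p : α × β => J p.1 p.2)

/-- `I(P,V)`: mutual information between input distributed by `P` and output of channel `V`. -/
def chanMI {α β : Type*} [Fintype α] [Fintype β] (P : α → ℝ) (V : α → β → ℝ) : ℝ :=
  miJoint (fun a b => P a * V a b)

/-- The n-fold memoryless extension of a channel. -/
def nfold {α β : Type*} (n : ℕ) (V : α → β → ℝ) : (Fin n → α) → (Fin n → β) → ℝ :=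
  fun a b => ∏ i, V (a i) (b i)

/-- Joint distribution of Alice's key `K_A` (uniform on `K`) and the key obtained
by sending `K_A` through the random coder `F`, the channel `V`, and the decoder `f`. -/
def keyJoint {K A B : Type*} [Fintype K] [Fintype A] [Fintype B] [DecidableEq K]
    (F : K → A → ℝ) (V : A → B → ℝ) (f : B → K) : K → K → ℝ :=
  fun k k' => (Fintype.card K : ℝ)⁻¹ * ∑ a, F k a * ∑ b, if f b = k' then V a b else 0

/-- A density matrix: positive semidefinite with trace 1. -/
def IsDensity {ι : Type*} [Fintype ι] (ρ : Matrix ι ι ℂ) : Prop :=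
  ρ.PosSemidef ∧ ρ.trace = 1

/-- A POVM with outcomes in `B`: positive semidefinite operators summing to the identity. -/
def IsPOVM {ι B : Type*} [Fintype ι] [DecidableEq ι] [Fintype B]
    (M : B → Matrix ι ι ℂ) : Prop :=
  (∀ b, (M b).PosSemidef) ∧ ∑ b, M b = 1

/-- Von Neumann entropy (in bits) of a Hermitian matrix, via its eigenvalues. -/
def vnEntropy {ι : Type*} [Fintype ι] [DecidableEq ι] (ρ : Matrix ι ι ℂ) : ℝ :=
  if h : ρ.IsHermitian then (∑ i, Real.negMulLog (h.eigenvalues i)) / Real.log 2 else 0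

/-- The Holevo quantity χ(P, ξ) of the ensemble `{P(a), ξ(a)}`. -/
def holevo {A ι : Type*} [Fintype A] [Fintype ι] [DecidableEq ι]
    (P : A → ℝ) (ξ : A → Matrix ι ι ℂ) : ℝ :=
  vnEntropy (∑ a, (P a : ℂ) • ξ a) - ∑ a, P a * vnEntropy (ξ a)

/-- Probability of outcome `b` when measuring the state `ρ` with the POVM `M`. -/
def measProb {ι B : Type*} [Fintype ι] (M : B → Matrix ι ι ℂ)
    (ρ : Matrix ι ι ℂ) (b : B) : ℝ :=
  ((M b * ρ).trace).re

/-- Mutual information (in bits) between an input `a ~ P` and the outcome of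
measuring `ξ(a)` with the POVM `M`. -/
def measMI {A ι B : Type*} [Fintype A] [Fintype ι] [Fintype B]
    (P : A → ℝ) (ξ : A → Matrix ι ι ℂ) (M : B → Matrix ι ι ℂ) : ℝ :=
  miJoint (fun a b => P a * measProb M (ξ a) b)

/-- The tensor-power state `ξ(a₁) ⊗ ⋯ ⊗ ξ(a_n)`. -/
def tensPow {A ι : Type*} {n : ℕ} (ξ : A → Matrix ι ι ℂ) (a : Fin n → A) :
    Matrix (Fin n → ι) (Fin n → ι) ℂ :=
  Matrix.of fun v w => ∏ i, ξ (a i) (v i) (w i)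

/-- The set of Holevo quantities over all input distributions. -/
def holevoSet {A ι : Type*} [Fintype A] [Fintype ι] [DecidableEq ι]
    (ξ : A → Matrix ι ι ℂ) : Set ℝ :=
  { x | ∃ P : A → ℝ, IsProbDist P ∧ x = holevo P ξ }

/-- The set of accessible informations: mutual informations achievable with some
input distribution and some POVM (with an arbitrary finite outcome set). -/
def accInfoSet {A ι : Type*} [Fintype A] [Fintype ι] [DecidableEq ι]
    (ξ : A → Matrix ι ι ℂ) : Set ℝ :=
  { x | ∃ (P : A → ℝ) (m : ℕ) (M : Fin m → Matrix ι ι ℂ),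
      IsProbDist P ∧ IsPOVM M ∧ x = measMI P ξ M }


/-- Applying a matrix map blockwise on `ι × Fin m` (i.e. `Θ ⊗ id_m`). -/
def matBlock {ι κ : Type*} (m : ℕ) (Θ : Matrix ι ι ℂ →ₗ[ℂ] Matrix κ κ ℂ)
    (X : Matrix (ι × Fin m) (ι × Fin m) ℂ) : Matrix (κ × Fin m) (κ × Fin m) ℂ :=
  Matrix.of fun p q => Θ (Matrix.of fun a b => X (a, p.2) (b, q.2)) p.1 q.1

/-- A quantum channel: a completely positive trace-preserving linear map. -/
def IsCPTP {ι κ : Type*} [Fintype ι] [Fintype κ]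
    (Θ : Matrix ι ι ℂ →ₗ[ℂ] Matrix κ κ ℂ) : Prop :=
  (∀ (m : ℕ) (X : Matrix (ι × Fin m) (ι × Fin m) ℂ),
      X.PosSemidef → (matBlock m Θ X).PosSemidef) ∧
  ∀ X, (Θ X).trace = X.trace

/-- Partial trace over Eve's factor (the second component). -/
def ptraceE {dB dE : ℕ} (ρ : Matrix (Fin dB × Fin dE) (Fin dB × Fin dE) ℂ) :
    Matrix (Fin dB) (Fin dB) ℂ :=
  Matrix.of fun i j => ∑ e, ρ (i, e) (j, e)

/-- Partial trace over Bob's factor (the first component). -/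
def ptraceB {dB dE : ℕ} (ρ : Matrix (Fin dB × Fin dE) (Fin dB × Fin dE) ℂ) :
    Matrix (Fin dE) (Fin dE) ℂ :=
  Matrix.of fun i j => ∑ b, ρ (b, i) (b, j)

/-- Joint distribution of `(K_A, K_B, K_E)` in the quantum key distribution scheme:
`K_A` is uniform on `K`; `aⁿ` is sampled from the random coder `F`; the state
`Θ(ξ(a₁)) ⊗ ⋯ ⊗ Θ(ξ(a_n))` is produced; Bob measures the POVM `MB` on his `n`
subsystems and Eve measures the factorized POVM `⊗ᵢ Mi i` followed by classical
post-processing `f` on her `n` subsystems. -/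
def qkdJoint {K A E : Type*} [Fintype K] [Fintype A] [Fintype E] [DecidableEq K]
    {dA dB dE n : ℕ}
    (Θ : Matrix (Fin dA) (Fin dA) ℂ →ₗ[ℂ] Matrix (Fin dB × Fin dE) (Fin dB × Fin dE) ℂ)
    (ξ : A → Matrix (Fin dA) (Fin dA) ℂ)
    (F : K → (Fin n → A) → ℝ)
    (MB : K → Matrix (Fin n → Fin dB) (Fin n → Fin dB) ℂ)
    (Mi : Fin n → E → Matrix (Fin dE) (Fin dE) ℂ)
    (f : (Fin n → E) → K)
    (k kB kE : K) : ℝ :=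
  (Fintype.card K : ℝ)⁻¹ * ∑ a : Fin n → A, F k a *
    ∑ e : Fin n → E, if f e = kE then
      (((Matrix.of fun v w : Fin n → Fin dB × Fin dE =>
            MB kB (fun i => (v i).1) (fun i => (w i).1) *
              ∏ i, Mi i (e i) ((v i).2) ((w i).2)) *
          tensPow (fun a' => Θ (ξ a')) a).trace).re
    else 0

set_option linter.unusedSectionVars false

/-! ### Finite product probability -/

/-- Product weight. -/
def pw {J Y : Type*} [Fintype J] (p : J → Y → ℝ) (x : J → Y) : ℝ := ∏ j, p j (x j)

open Classical in
/-- Probability of an event under a weight function. -/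
def PR {X : Type*} [Fintype X] (w : X → ℝ) (B : X → Prop) : ℝ :=
  ∑ x, if B x then w x else 0

lemma sum_pi_prod {R J Y : Type*} [CommSemiring R] [Fintype J] [DecidableEq J] [Fintype Y]
    (h : J → Y → R) : ∑ x : J → Y, ∏ j, h j (x j) = ∏ j, ∑ y, h j y := by
  rw [Finset.prod_univ_sum, Fintype.piFinset_univ]

lemma pw_nonneg {J Y : Type*} [Fintype J] {p : J → Y → ℝ} (hp : ∀ j y, 0 ≤ p j y)
    (x : J → Y) : 0 ≤ pw p x := Finset.prod_nonneg fun j _ => hp j _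

lemma pw_sum {J Y : Type*} [Fintype J] [DecidableEq J] [Fintype Y] {p : J → Y → ℝ}
    (hp : ∀ j, ∑ y, p j y = 1) : ∑ x, pw p x = 1 := by
  unfold pw
  rw [sum_pi_prod]
  simp [hp]

lemma pw_isProb {J Y : Type*} [Fintype J] [DecidableEq J] [Fintype Y] {p : J → Y → ℝ}
    (hp : ∀ j, IsProbDist (p j)) : IsProbDist (pw p) :=
  ⟨pw_nonneg fun j => (hp j).1, pw_sum fun j => (hp j).2⟩

lemma pw_exp_prod {J Y : Type*} [Fintype J] [DecidableEq J] [Fintype Y] (p : J → Y → ℝ)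
    (h : J → Y → ℝ) :
    ∑ x, pw p x * ∏ j, h j (x j) = ∏ j, ∑ y, p j y * h j y := by
  unfold pw
  simp_rw [← Finset.prod_mul_distrib]
  exact sum_pi_prod (fun j y => p j y * h j y)

lemma pw_exp1 {J Y : Type*} [Fintype J] [DecidableEq J] [Fintype Y] {p : J → Y → ℝ}
    (hp : ∀ j, ∑ y, p j y = 1) (j : J) (g : Y → ℝ) :
    ∑ x, pw p x * g (x j) = ∑ y, p j y * g y := by
  have h1 : ∀ x : J → Y, g (x j) = ∏ i, (if i = j then g (x i) else 1) := by
    intro x; simp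
  have := pw_exp_prod p (fun i y => if i = j then g y else 1)
  simp_rw [h1]
  rw [this, Finset.prod_eq_single j]
  · simp
  · intro b _ hb; simp [hb, hp]
  · simp

lemma pw_exp2_mul {J Y : Type*} [Fintype J] [DecidableEq J] [Fintype Y] {p : J → Y → ℝ}
    (hp : ∀ j, ∑ y, p j y = 1) {j k : J} (hjk : j ≠ k) (g h : Y → ℝ) :
    ∑ x, pw p x * (g (x j) * h (x k)) = (∑ y, p j y * g y) * (∑ y, p k y * h y) := by
  have h1 : ∀ x : J → Y, g (x j) * h (x k) =
      ∏ i, ((if i = j then g (x i) else 1) * (if i = k then h (x i) else 1)) := by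
    intro x; rw [Finset.prod_mul_distrib]; simp
  have := pw_exp_prod p (fun i y => (if i = j then g y else 1) * (if i = k then h y else 1))
  simp_rw [h1]
  rw [this]
  have h2 : ∀ i, (∑ y, p i y * ((if i = j then g y else 1) * (if i = k then h y else 1))) =
      (if i = j then ∑ y, p i y * g y else 1) * (if i = k then ∑ y, p i y * h y else 1) := by
    intro i
    by_cases hi : i = j
    · have : i ≠ k := fun h => hjk (hi.symm.trans h)
      simp [hi, hjk]
    · by_cases hk : i = k
      · simp [hk, hjk.symm]
      · simp [hi, hk, hp]
  simp_rw [h2]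
  rw [Finset.prod_mul_distrib]
  simp

lemma pw_exp2 {J Y : Type*} [Fintype J] [DecidableEq J] [Fintype Y] {p : J → Y → ℝ}
    (hp : ∀ j, ∑ y, p j y = 1) {j k : J} (hjk : j ≠ k) (g : Y → Y → ℝ) :
    ∑ x, pw p x * g (x j) (x k) = ∑ y, ∑ z, p j y * (p k z * g y z) := by
  classical
  have h1 : ∀ x : J → Y, pw p x * g (x j) (x k) =
      ∑ y, pw p x * ((if x j = y then 1 else 0) * g y (x k)) := by
    intro x; simp
  simp_rw [h1]
  rw [Finset.sum_comm]
  refine Finset.sum_congr rfl fun y _ => ?_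
  rw [pw_exp2_mul hp hjk (fun u => if u = y then 1 else 0) (fun z => g y z)]
  rw [← Finset.mul_sum]
  simp

lemma PR_nonneg {X : Type*} [Fintype X] {w : X → ℝ} (hw : ∀ x, 0 ≤ w x) (B : X → Prop) :
    0 ≤ PR w B := by
  unfold PR
  refine Finset.sum_nonneg fun x _ => ?_
  split_ifs
  · exact hw x
  · exact le_rfl

lemma PR_mono {X : Type*} [Fintype X] {w : X → ℝ} (hw : ∀ x, 0 ≤ w x) {B C : X → Prop}
    (h : ∀ x, 0 < w x → B x → C x) : PR w B ≤ PR w C := by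
  unfold PR
  refine Finset.sum_le_sum fun x _ => ?_
  rcases (hw x).eq_or_lt with h0 | h0
  · simp [← h0]
  · by_cases hB : B x
    · simp [hB, h x h0 hB]
    · by_cases hC : C x <;> simp [hB, hC, h0.le]

/-- Markov inequality in a form convenient for us. -/
lemma PR_le_exp {X : Type*} [Fintype X] {w : X → ℝ} (hw : ∀ x, 0 ≤ w x) {B : X → Prop}
    {g : X → ℝ} (hg : ∀ x, 0 ≤ g x) (h : ∀ x, B x → 1 ≤ g x) : PR w B ≤ ∑ x, w x * g x := by
  unfold PR
  refine Finset.sum_le_sum fun x _ => ?_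
  split_ifs with hB
  · exact le_mul_of_one_le_right (hw x) (h x hB)
  · exact mul_nonneg (hw x) (hg x)

lemma PR_or {X : Type*} [Fintype X] {w : X → ℝ} (hw : ∀ x, 0 ≤ w x) (B C : X → Prop) :
    PR w (fun x => B x ∨ C x) ≤ PR w B + PR w C := by
  unfold PR
  rw [← Finset.sum_add_distrib]
  refine Finset.sum_le_sum fun x _ => ?_
  have := hw x
  by_cases hB : B x <;> by_cases hC : C x <;> simp [hB, hC, this]

lemma PR_exists {X T : Type*} [Fintype X] [Fintype T] {w : X → ℝ} (hw : ∀ x, 0 ≤ w x)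
    (B : T → X → Prop) {b : ℝ} (hb : ∀ t, PR w (B t) ≤ b) :
    PR w (fun x => ∃ t, B t x) ≤ Fintype.card T * b := by
  calc PR w (fun x => ∃ t, B t x) ≤ ∑ t, PR w (B t) := by
        unfold PR
        rw [Finset.sum_comm]
        refine Finset.sum_le_sum fun x _ => ?_
        split_ifs with h
        · obtain ⟨t, ht⟩ := h
          have := Finset.single_le_sum (f := fun t => open Classical in if B t x then w x else 0)
            (fun i _ => by
              show 0 ≤ _
              split_ifs
              · exact hw x
              · exact le_rfl) (Finset.mem_univ t)
          simpa [ht] using this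
        · refine Finset.sum_nonneg fun i _ => ?_
          split_ifs
          · exact hw x
          · exact le_rfl
    _ ≤ ∑ t : T, b := Finset.sum_le_sum fun t _ => hb t
    _ = _ := by simp

lemma exists_of_PR_lt {X : Type*} [Fintype X] {w : X → ℝ} (hw : ∑ x, w x = 1)
    {B : X → Prop} (h : PR w B < 1) : ∃ x, ¬ B x := by
  by_contra hcon
  push Not at hcon
  unfold PR at h
  simp [hcon, hw] at h

lemma exists_of_exp_lt {X : Type*} [Fintype X] {w : X → ℝ} (hw : IsProbDist w)
    {B : X → Prop} {g : X → ℝ} (hg : ∀ x, 0 ≤ g x) {ε : ℝ} (hε : 0 < ε)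
    (h : PR w B + (∑ x, w x * g x) / ε < 1) : ∃ x, ¬ B x ∧ g x < ε := by
  have h2 : PR w (fun x => ε ≤ g x) ≤ (∑ x, w x * g x) / ε := by
    refine (PR_le_exp hw.1 (g := fun x => g x / ε) (fun x => div_nonneg (hg x) hε.le)
      (fun x hx => (one_le_div hε).2 hx)).trans_eq ?_
    rw [Finset.sum_div]
    exact Finset.sum_congr rfl fun x _ => by ring
  obtain ⟨x, hx⟩ := exists_of_PR_lt hw.2 (B := fun x => B x ∨ ε ≤ g x)
    (lt_of_le_of_lt (PR_or hw.1 _ _) (by linarith))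
  push Not at hx
  exact ⟨x, hx⟩

/-- Chebyshev inequality for independent variables. -/
lemma chebyshev {Z : Type*} [Fintype Z] {n : ℕ} (hn : 0 < n) {p : Fin n → Z → ℝ}
    (hp : ∀ i, IsProbDist (p i)) (g : Fin n → Z → ℝ) {C δ : ℝ} (hδ : 0 < δ)
    (hC : ∀ i, ∑ z, p i z * g i z ^ 2 ≤ C) :
    PR (pw p) (fun x => n * δ ≤ ∑ i, (g i (x i) - ∑ z, p i z * g i z)) ≤ C / (n * δ ^ 2) := by
  have hn' : (0 : ℝ) < n := by exact_mod_cast hn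
  set h : Fin n → Z → ℝ := fun i z => g i z - ∑ z, p i z * g i z with hh
  have hs : ∀ i, ∑ z, p i z = 1 := fun i => (hp i).2
  have h0 : ∀ i, ∑ z, p i z * h i z = 0 := by
    intro i
    simp [hh, mul_sub, Finset.sum_sub_distrib, ← Finset.sum_mul, hs]
  have h2 : ∀ i, ∑ z, p i z * (h i z * h i z) ≤ C := by
    intro i
    refine le_trans ?_ (hC i)
    have : ∑ z, p i z * (h i z * h i z) = ∑ z, p i z * g i z ^ 2 - (∑ z, p i z * g i z) ^ 2 := by
      have : ∀ z, p i z * (h i z * h i z) = p i z * g i z ^ 2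
          - 2 * (∑ z, p i z * g i z) * (p i z * g i z) + (∑ z, p i z * g i z) ^ 2 * p i z := by
        intro z; simp only [hh]; ring
      simp_rw [this]
      rw [Finset.sum_add_distrib, Finset.sum_sub_distrib, ← Finset.mul_sum, ← Finset.mul_sum, hs]
      ring
    rw [this]
    nlinarith [sq_nonneg (∑ z, p i z * g i z)]
  have hE : ∑ x, pw p x * (∑ i, h i (x i)) ^ 2 ≤ n * C := by
    have e1 : ∀ x : Fin n → Z, pw p x * (∑ i, h i (x i)) ^ 2 =
        ∑ i, ∑ j, pw p x * (h i (x i) * h j (x j)) := by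
      intro x
      rw [sq, Finset.sum_mul_sum, Finset.mul_sum]
      simp_rw [Finset.mul_sum]
    simp_rw [e1]
    rw [Finset.sum_comm]
    have e2 : ∀ i, ∑ x : Fin n → Z, ∑ j, pw p x * (h i (x i) * h j (x j)) ≤ C := by
      intro i
      rw [Finset.sum_comm, Finset.sum_eq_single i]
      · rw [pw_exp1 hs i (fun z => h i z * h i z)]
        exact h2 i
      · intro j _ hj
        rw [pw_exp2_mul hs hj.symm (h i) (h j), h0, zero_mul]
      · simp
    calc _ ≤ ∑ i : Fin n, C := Finset.sum_le_sum fun i _ => e2 i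
      _ = n * C := by simp
  have hw : ∀ x, 0 ≤ pw p x := pw_nonneg fun i => (hp i).1
  refine (PR_le_exp hw (g := fun x => (∑ i, h i (x i)) ^ 2 / (n * δ) ^ 2)
    (fun x => by positivity) ?_).trans ?_
  · intro x hx
    rw [one_le_div (by positivity)]
    exact pow_le_pow_left₀ (by positivity) hx 2
  · have : ∑ x, pw p x * ((∑ i, h i (x i)) ^ 2 / (n * δ) ^ 2) =
        (∑ x, pw p x * (∑ i, h i (x i)) ^ 2) / (n * δ) ^ 2 := by
      rw [Finset.sum_div]
      exact Finset.sum_congr rfl fun x _ => by ring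
    rw [this]
    calc _ ≤ n * C / (n * δ) ^ 2 := by gcongr
      _ = _ := by field_simp

/-- Lower-tail Chernoff bound. -/
lemma chernoff {J Y : Type*} [Fintype J] [DecidableEq J] [Fintype Y] {p : Y → ℝ}
    (hp : IsProbDist p) (S : Finset J) (X : Y → ℝ) {b q ε : ℝ} (hb : 0 < b) (hε : 0 < ε)
    (hX0 : ∀ y, 0 ≤ X y) (hXb : ∀ y, X y ≤ b) (hq : ∑ y, p y * X y ≤ q) :
    PR (pw fun _ : J => p) (fun x => ∑ j ∈ S, X (x j) ≤ S.card * (∑ y, p y * X y - ε * q)) ≤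
      Real.exp (-(S.card * ε ^ 2 * q / (2 * b))) := by
  set μ := ∑ y, p y * X y with hμ
  set t := ε / b with ht
  have ht0 : 0 < t := by positivity
  have hexp : ∀ u : ℝ, 0 ≤ u → Real.exp (-u) ≤ 1 - u + u ^ 2 / 2 := by
    intro u hu
    rw [Real.exp_neg, inv_le_comm₀ (Real.exp_pos _) (by nlinarith [sq_nonneg (u - 1)])]
    refine le_trans ?_ (Real.quadratic_le_exp_of_nonneg hu)
    rw [inv_le_iff_one_le_mul₀ (by nlinarith [sq_nonneg (u - 1)])]
    nlinarith [sq_nonneg (u ^ 2)]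
  have hmgf : ∑ y, p y * Real.exp (-(t * X y)) ≤ Real.exp (-(t * μ) + t ^ 2 * b * μ / 2) := by
    calc ∑ y, p y * Real.exp (-(t * X y))
        ≤ ∑ y, p y * (1 - t * X y + t ^ 2 * b * X y / 2) := by
          refine Finset.sum_le_sum fun y _ => mul_le_mul_of_nonneg_left ?_ (hp.1 y)
          refine (hexp _ (mul_nonneg ht0.le (hX0 y))).trans ?_
          have : X y ^ 2 ≤ b * X y := by nlinarith [hX0 y, hXb y]
          have := mul_le_mul_of_nonneg_left this (sq_nonneg t)
          nlinarith
      _ = 1 + (-(t * μ) + t ^ 2 * b * μ / 2) := by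
          have : ∀ y, p y * (1 - t * X y + t ^ 2 * b * X y / 2) =
            p y + (-t + t ^ 2 * b / 2) * (p y * X y) := by intro y; ring
          simp_rw [this]
          rw [Finset.sum_add_distrib, ← Finset.mul_sum, hp.2, ← hμ]; ring
      _ ≤ _ := by rw [add_comm]; exact Real.add_one_le_exp _
  have hw : ∀ x, 0 ≤ pw (fun _ : J => p) x := pw_nonneg fun i => hp.1
  refine (PR_le_exp hw (g := fun x => Real.exp (t * (S.card * (μ - ε * q))) *
      ∏ j, (if j ∈ S then Real.exp (-(t * X (x j))) else 1)) (fun x => ?_) ?_).trans ?_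
  · refine mul_nonneg (Real.exp_pos _).le (Finset.prod_nonneg fun j _ => ?_)
    split_ifs
    · exact (Real.exp_pos _).le
    · exact zero_le_one
  · intro x hx
    rw [Finset.prod_ite_mem, Finset.univ_inter, ← Real.exp_sum, ← Real.exp_add]
    rw [Finset.sum_neg_distrib, ← Finset.mul_sum]
    apply Real.one_le_exp
    nlinarith
  · have e : ∀ x : J → Y, pw (fun _ : J => p) x * (Real.exp (t * (S.card * (μ - ε * q))) *
      ∏ j, (if j ∈ S then Real.exp (-(t * X (x j))) else 1)) =
      Real.exp (t * (S.card * (μ - ε * q))) * (pw (fun _ : J => p) x * 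
      ∏ j, (if j ∈ S then Real.exp (-(t * X (x j))) else 1)) := by intro x; ring
    simp_rw [e]
    rw [← Finset.mul_sum, pw_exp_prod (fun _ : J => p)
      (fun j y => if j ∈ S then Real.exp (-(t * X y)) else 1)]
    have e2 : ∏ j, ∑ y, p y * (if j ∈ S then Real.exp (-(t * X y)) else 1) ≤
        Real.exp (-(t * μ) + t ^ 2 * b * μ / 2) ^ S.card := by
      have : ∀ j, ∑ y, p y * (if j ∈ S then Real.exp (-(t * X y)) else 1) =
          if j ∈ S then ∑ y, p y * Real.exp (-(t * X y)) else 1 := by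
        intro j; split_ifs <;> simp [hp.2]
      simp_rw [this]
      rw [Finset.prod_ite_mem, Finset.univ_inter, Finset.prod_const]
      exact pow_le_pow_left₀ (Finset.sum_nonneg fun y _ =>
        mul_nonneg (hp.1 y) (Real.exp_pos _).le) hmgf _
    refine (mul_le_mul_of_nonneg_left e2 (Real.exp_pos _).le).trans ?_
    rw [← Real.exp_nat_mul, ← Real.exp_add]
    apply Real.exp_le_exp.2
    have hS : (0 : ℝ) ≤ S.card := Nat.cast_nonneg _
    have h3 : t ^ 2 * b * μ / 2 ≤ ε ^ 2 * q / (2 * b) := by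
      have : t ^ 2 * b = ε ^ 2 / b := by rw [ht]; field_simp
      rw [this]
      calc ε ^ 2 / b * μ / 2 ≤ ε ^ 2 / b * q / 2 := by gcongr
        _ = _ := by field_simp
    have h4 : t * ε * q = 2 * (ε ^ 2 * q / (2 * b)) := by rw [ht]; field_simp
    have h5 := mul_le_mul_of_nonneg_left h3 hS
    have h6 : S.card * ε ^ 2 * q / (2 * b) = S.card * (ε ^ 2 * q / (2 * b)) := by ring
    rw [h6]
    have h7 : t * (S.card * (μ - ε * q)) = S.card * (t * μ) - S.card * (t * ε * q) := by ring
    rw [h7, h4]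
    nlinarith

/-! ### Mutual information -/

lemma log2_pos : 0 < Real.log 2 := Real.log_pos (by norm_num)

lemma miJoint_eq {α β : Type*} [Fintype α] [Fintype β] {J : α → β → ℝ}
    (hJ : ∀ a b, 0 ≤ J a b) :
    miJoint J * Real.log 2 =
      ∑ a, ∑ b, J a b * Real.log (J a b / ((∑ b, J a b) * ∑ a, J a b)) := by
  have hr : ∀ a b, J a b ≤ ∑ b, J a b := fun a b =>
    Finset.single_le_sum (f := fun b => J a b) (fun b _ => hJ a b) (Finset.mem_univ b)
  have hc : ∀ a b, J a b ≤ ∑ a, J a b := fun a b =>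
    Finset.single_le_sum (f := fun a => J a b) (fun a _ => hJ a b) (Finset.mem_univ a)
  have h1 : ∀ a b, J a b * Real.log (J a b / ((∑ b, J a b) * ∑ a, J a b)) =
      J a b * Real.log (J a b) - J a b * Real.log (∑ b, J a b)
        - J a b * Real.log (∑ a, J a b) := by
    intro a b
    rcases (hJ a b).eq_or_lt with h | h
    · simp [← h]
    · have h2 := h.trans_le (hr a b)
      have h3 := h.trans_le (hc a b)
      rw [Real.log_div h.ne' (mul_pos h2 h3).ne', Real.log_mul h2.ne' h3.ne']
      ring
  simp_rw [h1, Finset.sum_sub_distrib]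
  unfold miJoint entropy
  rw [sub_mul, add_mul, div_mul_cancel₀ _ log2_pos.ne', div_mul_cancel₀ _ log2_pos.ne',
    div_mul_cancel₀ _ log2_pos.ne', Fintype.sum_prod_type]
  simp only [Real.negMulLog]
  have e1 : ∑ a, ∑ b, J a b * Real.log (∑ b, J a b) =
      ∑ a, (∑ b, J a b) * Real.log (∑ b, J a b) := by
    simp_rw [Finset.sum_mul]
  have e2 : ∑ a, ∑ b, J a b * Real.log (∑ a, J a b) =
      ∑ b, (∑ a, J a b) * Real.log (∑ a, J a b) := by
    rw [Finset.sum_comm]; simp_rw [Finset.sum_mul]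
  rw [e1, e2]
  simp only [neg_mul, Finset.sum_neg_distrib]
  ring

lemma miJoint_nonneg {α β : Type*} [Fintype α] [Fintype β] {J : α → β → ℝ}
    (hJ : ∀ a b, 0 ≤ J a b) (h1 : ∑ a, ∑ b, J a b = 1) : 0 ≤ miJoint J := by
  have hr : ∀ a b, J a b ≤ ∑ b, J a b := fun a b =>
    Finset.single_le_sum (f := fun b => J a b) (fun b _ => hJ a b) (Finset.mem_univ b)
  have hc : ∀ a b, J a b ≤ ∑ a, J a b := fun a b =>
    Finset.single_le_sum (f := fun a => J a b) (fun a _ => hJ a b) (Finset.mem_univ a)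
  have : 0 ≤ miJoint J * Real.log 2 := by
    rw [miJoint_eq hJ]
    have h2 : ∑ a, ∑ b, (J a b - (∑ b, J a b) * ∑ a, J a b) = 0 := by
      simp_rw [Finset.sum_sub_distrib, ← Finset.mul_sum]
      rw [← Finset.sum_mul, Finset.sum_comm (f := fun b a => J a b), h1]; ring
    rw [← h2]
    refine Finset.sum_le_sum fun a _ => Finset.sum_le_sum fun b _ => ?_
    rcases (hJ a b).eq_or_lt with h | h
    · rw [← h]
      simp only [zero_mul, zero_sub]
      have : 0 ≤ (∑ b, J a b) * ∑ a, J a b :=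
        mul_nonneg ((hJ a b).trans (hr a b)) ((hJ a b).trans (hc a b))
      linarith
    · have h2 := h.trans_le (hr a b)
      have h3 := h.trans_le (hc a b)
      have h4 := Real.one_sub_inv_le_log_of_pos (div_pos h (mul_pos h2 h3))
      have h5 := mul_le_mul_of_nonneg_left h4 h.le
      refine le_trans (le_of_eq ?_) h5
      field_simp
  exact nonneg_of_mul_nonneg_left this log2_pos

lemma miJoint_le_card {α β : Type*} [Fintype α] [Fintype β] {J : α → β → ℝ}
    (hJ : ∀ a b, 0 ≤ J a b) :
    miJoint J * Real.log 2 ≤ Fintype.card α := by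
  have hr : ∀ a b, J a b ≤ ∑ b, J a b := fun a b =>
    Finset.single_le_sum (f := fun b => J a b) (fun b _ => hJ a b) (Finset.mem_univ b)
  have hc : ∀ a b, J a b ≤ ∑ a, J a b := fun a b =>
    Finset.single_le_sum (f := fun a => J a b) (fun a _ => hJ a b) (Finset.mem_univ a)
  rw [miJoint_eq hJ]
  have : ∀ a, ∑ b, J a b * Real.log (J a b / ((∑ b, J a b) * ∑ a, J a b)) ≤ 1 := by
    intro a
    have hra : 0 ≤ ∑ b, J a b := Finset.sum_nonneg fun b _ => hJ a b
    calc _ ≤ ∑ b, J a b * (- Real.log (∑ b, J a b)) := by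
          refine Finset.sum_le_sum fun b _ => ?_
          rcases (hJ a b).eq_or_lt with h | h
          · simp [← h]
          · have h2 := h.trans_le (hr a b)
            have h3 := h.trans_le (hc a b)
            refine mul_le_mul_of_nonneg_left ?_ h.le
            rw [← Real.log_inv]
            refine Real.log_le_log (div_pos h (mul_pos h2 h3)) ?_
            rw [div_le_iff₀ (mul_pos h2 h3)]
            rw [← mul_assoc, inv_mul_cancel₀ h2.ne', one_mul]
            exact hc a b
      _ = (∑ b, J a b) * (- Real.log (∑ b, J a b)) := by rw [Finset.sum_mul]
      _ ≤ 1 := by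
          rcases hra.eq_or_lt with h | h
          · simp [← h]
          · have := Real.one_sub_inv_le_log_of_pos h
            have := mul_le_mul_of_nonneg_left this h.le
            rw [mul_sub, mul_inv_cancel₀ h.ne'] at this
            linarith
  calc _ ≤ ∑ a : α, (1 : ℝ) := Finset.sum_le_sum fun a _ => this a
    _ = _ := by simp

/-- If all conditional laws are close to a common one, the mutual information is small. -/
lemma miJoint_le_of_close {K B : Type*} [Fintype K] [Fintype B] [Nonempty K]
    {G : K → B → ℝ} (hG : IsChannel G) (D : B → ℝ) {ε : ℝ}
    (h : ∀ k, ∑ b, |G k b - D b| ≤ ε) :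
    miJoint (fun k b => (Fintype.card K : ℝ)⁻¹ * G k b) * Real.log 2 ≤
      2 * Fintype.card K * ε := by
  set c : ℝ := (Fintype.card K : ℝ) with hc
  have hcpos : 0 < c := by rw [hc]; exact_mod_cast Fintype.card_pos
  set q : B → ℝ := fun b => ∑ k, c⁻¹ * G k b with hq
  have hGq : ∀ k b, c⁻¹ * G k b ≤ q b := fun k b =>
    Finset.single_le_sum (f := fun k => c⁻¹ * G k b)
      (fun k _ => mul_nonneg (inv_nonneg.2 hcpos.le) (hG.1 k b)) (Finset.mem_univ k)
  rw [miJoint_eq (fun k b => mul_nonneg (inv_nonneg.2 hcpos.le) (hG.1 k b))]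
  have hrow : ∀ k, ∑ b, c⁻¹ * G k b = c⁻¹ := by
    intro k; rw [← Finset.mul_sum, hG.2, mul_one]
  simp_rw [hrow]
  have hqD : ∑ b, |D b - q b| ≤ ε := by
    have e : ∀ b, |D b - q b| ≤ ∑ k, c⁻¹ * |G k b - D b| := by
      intro b
      have : D b - q b = ∑ k, c⁻¹ * (D b - G k b) := by
        simp only [mul_sub, Finset.sum_sub_distrib, hq]
        rw [Finset.sum_const, Finset.card_univ, nsmul_eq_mul, ← hc, ← mul_assoc,
          mul_inv_cancel₀ hcpos.ne', one_mul]
      rw [this]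
      refine (Finset.abs_sum_le_sum_abs _ _).trans (le_of_eq ?_)
      refine Finset.sum_congr rfl fun k _ => ?_
      rw [abs_mul, abs_of_pos (inv_pos.2 hcpos), abs_sub_comm]
    calc _ ≤ ∑ b, ∑ k, c⁻¹ * |G k b - D b| := Finset.sum_le_sum fun b _ => e b
      _ = ∑ k, c⁻¹ * ∑ b, |G k b - D b| := by rw [Finset.sum_comm]; simp_rw [Finset.mul_sum]
      _ ≤ ∑ k : K, c⁻¹ * ε := Finset.sum_le_sum fun k _ =>
          mul_le_mul_of_nonneg_left (h k) (inv_nonneg.2 hcpos.le)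
      _ = ε := by
          rw [Finset.sum_const, Finset.card_univ, nsmul_eq_mul, ← hc, ← mul_assoc,
            mul_inv_cancel₀ hcpos.ne', one_mul]
  have hk : ∀ k, ∑ b, c⁻¹ * G k b * Real.log (c⁻¹ * G k b / (c⁻¹ * ∑ k, c⁻¹ * G k b)) ≤
      2 * ε := by
    intro k
    calc _ ≤ ∑ b, (|G k b - D b| + |D b - q b|) := by
          refine Finset.sum_le_sum fun b _ => ?_
          show c⁻¹ * G k b * Real.log (c⁻¹ * G k b / (c⁻¹ * q b)) ≤ _
          refine le_trans ?_ (abs_sub_le (G k b) (D b) (q b))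
          rw [mul_div_mul_left _ _ (inv_pos.2 hcpos).ne']
          rcases (hG.1 k b).eq_or_lt with h0 | h0
          · simp [← h0]
          · have hq0 : 0 < q b := (mul_pos (inv_pos.2 hcpos) h0).trans_le (hGq k b)
            have h1 := Real.log_le_sub_one_of_pos (div_pos h0 hq0)
            have h2 : c⁻¹ * G k b / q b ≤ 1 := (div_le_one hq0).2 (hGq k b)
            have h3 : 0 ≤ c⁻¹ * G k b / q b := by positivity
            calc c⁻¹ * G k b * Real.log (G k b / q b) ≤ c⁻¹ * G k b * (G k b / q b - 1) :=
                  mul_le_mul_of_nonneg_left h1 (by positivity)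
              _ = (c⁻¹ * G k b / q b) * (G k b - q b) := by field_simp
              _ ≤ (c⁻¹ * G k b / q b) * |G k b - q b| :=
                  mul_le_mul_of_nonneg_left (le_abs_self _) h3
              _ ≤ 1 * |G k b - q b| := mul_le_mul_of_nonneg_right h2 (abs_nonneg _)
              _ = _ := one_mul _
      _ ≤ ε + ε := by rw [Finset.sum_add_distrib]; exact add_le_add (h k) hqD
      _ = 2 * ε := by ring
  calc _ ≤ ∑ k : K, 2 * ε := Finset.sum_le_sum fun k _ => hk k
    _ = _ := by rw [Finset.sum_const, Finset.card_univ, nsmul_eq_mul, ← hc]; ring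

/-- Output distribution. -/
def outD {A E : Type*} [Fintype A] (P : A → ℝ) (V : A → E → ℝ) (e : E) : ℝ := ∑ a, P a * V a e

lemma outD_nonneg {A E : Type*} [Fintype A] [Fintype E] {P : A → ℝ} (hP : IsProbDist P)
    {V : A → E → ℝ} (hV : IsChannel V) (e : E) : 0 ≤ outD P V e :=
  Finset.sum_nonneg fun a _ => mul_nonneg (hP.1 a) (hV.1 a e)

lemma le_outD {A E : Type*} [Fintype A] [Fintype E] {P : A → ℝ} (hP : IsProbDist P)
    {V : A → E → ℝ} (hV : IsChannel V) (a : A) (e : E) : P a * V a e ≤ outD P V e :=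
  Finset.single_le_sum (f := fun a => P a * V a e)
    (fun a _ => mul_nonneg (hP.1 a) (hV.1 a e)) (Finset.mem_univ a)

lemma outD_sum {A E : Type*} [Fintype A] [Fintype E] {P : A → ℝ} (hP : IsProbDist P)
    {V : A → E → ℝ} (hV : IsChannel V) : ∑ e, outD P V e = 1 := by
  unfold outD
  rw [Finset.sum_comm]
  simp_rw [← Finset.mul_sum, hV.2, mul_one]
  exact hP.2

lemma joint_isProb {A E : Type*} [Fintype A] [Fintype E] {P : A → ℝ} (hP : IsProbDist P)
    {V : A → E → ℝ} (hV : IsChannel V) : IsProbDist (fun z : A × E => P z.1 * V z.1 z.2) := by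
  refine ⟨fun z => mul_nonneg (hP.1 _) (hV.1 _ _), ?_⟩
  rw [Fintype.sum_prod_type]
  simp_rw [← Finset.mul_sum, hV.2, mul_one]
  exact hP.2

lemma chanMI_eq {A E : Type*} [Fintype A] [Fintype E] {P : A → ℝ} (hP : IsProbDist P)
    {V : A → E → ℝ} (hV : IsChannel V) :
    chanMI P V * Real.log 2 =
      ∑ z : A × E, P z.1 * V z.1 z.2 * Real.log (V z.1 z.2 / outD P V z.2) := by
  unfold chanMI
  rw [miJoint_eq (fun a b => mul_nonneg (hP.1 a) (hV.1 a b)), Fintype.sum_prod_type]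
  refine Finset.sum_congr rfl fun a _ => Finset.sum_congr rfl fun e _ => ?_
  simp_rw [← Finset.mul_sum, hV.2, mul_one]
  rcases (hP.1 a).eq_or_lt with h | h
  · simp [← h]
  · rw [mul_div_mul_left _ _ h.ne']
    rfl

lemma mul_log_sq_le {u : ℝ} (h0 : 0 < u) (h1 : u ≤ 1) : u * Real.log u ^ 2 ≤ 4 := by
  have hs : 0 < Real.sqrt u := Real.sqrt_pos.2 h0
  have hs1 : Real.sqrt u ≤ 1 := Real.sqrt_le_one.2 h1
  have h := Real.abs_log_mul_self_lt (Real.sqrt u) hs hs1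
  have h2 : Real.log u = 2 * Real.log (Real.sqrt u) := by
    rw [Real.log_sqrt h0.le]; ring
  have h3 : u = Real.sqrt u ^ 2 := (Real.sq_sqrt h0.le).symm
  have h4 : u * Real.log u ^ 2 = 4 * (Real.log (Real.sqrt u) * Real.sqrt u) ^ 2 := by
    rw [h2]; conv_lhs => rw [h3, Real.sqrt_sq hs.le]
    ring
  rw [h4]
  have := (sq_lt_one_iff_abs_lt_one _).2 h
  linarith

/-- Uniform second moment bound for the information density. -/
def momC {A : Type*} [Fintype A] (P : A → ℝ) : ℝ := 4 + ∑ a, P a * Real.log (P a) ^ 2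

lemma momC_pos {A : Type*} [Fintype A] {P : A → ℝ} (hP : IsProbDist P) : 0 < momC P := by
  have : 0 ≤ ∑ a, P a * Real.log (P a) ^ 2 :=
    Finset.sum_nonneg fun a _ => mul_nonneg (hP.1 a) (sq_nonneg _)
  unfold momC; linarith

lemma second_moment {A E : Type*} [Fintype A] [Fintype E] {P : A → ℝ} (hP : IsProbDist P)
    {V : A → E → ℝ} (hV : IsChannel V) :
    ∑ z : A × E, P z.1 * V z.1 z.2 * Real.log (V z.1 z.2 / outD P V z.2) ^ 2 ≤ momC P := by
  rw [Fintype.sum_prod_type]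
  have key : ∀ a e, P a * V a e * Real.log (V a e / outD P V e) ^ 2 ≤
      4 * (P a * outD P V e) + P a * Real.log (P a) ^ 2 * V a e := by
    intro a e
    have hQ := outD_nonneg hP hV e
    rcases (hP.1 a).eq_or_lt with h | h
    · simp [← h]
    rcases (hV.1 a e).eq_or_lt with h' | h'
    · rw [← h']; simp; exact mul_nonneg h.le hQ
    have hQ0 : 0 < outD P V e := (mul_pos h h').trans_le (le_outD hP hV a e)
    set u := V a e / outD P V e with hu
    have hu0 : 0 < u := div_pos h' hQ0
    have hVu : V a e = u * outD P V e := by rw [hu]; field_simp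
    rcases le_total u 1 with h1 | h1
    · have := mul_log_sq_le hu0 h1
      have t : 0 ≤ P a * Real.log (P a) ^ 2 * V a e := by positivity
      have : P a * V a e * Real.log u ^ 2 = P a * outD P V e * (u * Real.log u ^ 2) := by
        rw [hVu]; ring
      rw [this]
      have := mul_le_mul_of_nonneg_left (mul_log_sq_le hu0 h1) (mul_pos h hQ0).le
      linarith
    · have h2 : Real.log u ≤ - Real.log (P a) := by
        rw [← Real.log_inv]
        refine Real.log_le_log hu0 ?_
        rw [hu, div_le_iff₀ hQ0, inv_mul_eq_div, le_div_iff₀ h, mul_comm]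
        exact le_outD hP hV a e
      have h3 : 0 ≤ Real.log u := Real.log_nonneg h1
      have h4 : Real.log u ^ 2 ≤ Real.log (P a) ^ 2 := by nlinarith
      have h5 := mul_le_mul_of_nonneg_left h4 (mul_pos h h').le
      have t : 0 ≤ 4 * (P a * outD P V e) := by positivity
      linarith
  calc _ ≤ ∑ a, ∑ e, (4 * (P a * outD P V e) + P a * Real.log (P a) ^ 2 * V a e) :=
        Finset.sum_le_sum fun a _ => Finset.sum_le_sum fun e _ => key a e
    _ = momC P := by
        simp_rw [Finset.sum_add_distrib, ← Finset.mul_sum, hV.2, outD_sum hP hV, mul_one, hP.2]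
        rw [mul_one]; rfl

/-! ### Soft covering -/

/-- Memoryless (time-varying) channel. -/
def WV {A E : Type*} {n : ℕ} (V : Fin n → A → E → ℝ) (x : Fin n → A) (e : Fin n → E) : ℝ :=
  ∏ i, V i (x i) (e i)

/-- Its output distribution. -/
def QV {A E : Type*} [Fintype A] {n : ℕ} (P : A → ℝ) (V : Fin n → A → E → ℝ)
    (e : Fin n → E) : ℝ :=
  ∏ i, outD P (V i) (e i)

section
variable {A E : Type*} [Fintype A] [Fintype E] {n : ℕ}

lemma WV_nonneg {V : Fin n → A → E → ℝ} (hV : ∀ i, IsChannel (V i)) (x : Fin n → A)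
    (e : Fin n → E) : 0 ≤ WV V x e := Finset.prod_nonneg fun i _ => (hV i).1 _ _

lemma WV_sum {V : Fin n → A → E → ℝ} (hV : ∀ i, IsChannel (V i)) (x : Fin n → A) :
    ∑ e, WV V x e = 1 := by
  unfold WV
  rw [sum_pi_prod (fun i e => V i (x i) e)]
  simp [(hV _).2]

lemma QV_nonneg {P : A → ℝ} (hP : IsProbDist P) {V : Fin n → A → E → ℝ}
    (hV : ∀ i, IsChannel (V i)) (e : Fin n → E) : 0 ≤ QV P V e :=
  Finset.prod_nonneg fun i _ => outD_nonneg hP (hV i) _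

lemma QV_sum {P : A → ℝ} (hP : IsProbDist P) {V : Fin n → A → E → ℝ}
    (hV : ∀ i, IsChannel (V i)) : ∑ e, QV P V e = 1 := by
  unfold QV
  rw [sum_pi_prod (fun i e => outD P (V i) e)]
  simp [outD_sum hP (hV _)]

lemma QV_eq (P : A → ℝ) (V : Fin n → A → E → ℝ) (e : Fin n → E) :
    QV P V e = ∑ x, pw (fun _ : Fin n => P) x * WV V x e := by
  unfold QV WV outD
  rw [pw_exp_prod (fun _ : Fin n => P) (fun i a => V i a (e i))]

/-- The information density rarely exceeds its mean. -/
lemma density_tail (hn : 0 < n) {P : A → ℝ} (hP : IsProbDist P) {V : Fin n → A → E → ℝ}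
    (hV : ∀ i, IsChannel (V i)) {c δ : ℝ} (hδ : 0 < δ)
    (hc : ∀ i, chanMI P (V i) * Real.log 2 ≤ c) :
    PR (pw fun i => fun z : A × E => P z.1 * V i z.1 z.2)
      (fun z => Real.exp (n * (c + δ)) * QV P V (fun i => (z i).2) <
        WV V (fun i => (z i).1) (fun i => (z i).2)) ≤ momC P / (n * δ ^ 2) := by
  have hp : ∀ i, IsProbDist (fun z : A × E => P z.1 * V i z.1 z.2) :=
    fun i => joint_isProb hP (hV i)
  refine le_trans (PR_mono (pw_nonneg fun i => (hp i).1) ?_)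
    (chebyshev hn hp (fun i z => Real.log (V i z.1 z.2 / outD P (V i) z.2)) hδ
      fun i => second_moment hP (hV i))
  intro z hz hlt
  have hzi : ∀ i, 0 < P (z i).1 * V i (z i).1 (z i).2 := by
    intro i
    refine lt_of_le_of_ne ((hp i).1 (z i)) fun h => ?_
    have : pw (fun i => fun z : A × E => P z.1 * V i z.1 z.2) z = 0 :=
      Finset.prod_eq_zero (Finset.mem_univ i) h.symm
    exact hz.ne' this
  have hVi : ∀ i, 0 < V i (z i).1 (z i).2 := fun i =>
    lt_of_le_of_ne ((hV i).1 _ _) fun h => by have := hzi i; rw [← h] at this; simp at this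
  have hQi : ∀ i, 0 < outD P (V i) (z i).2 := fun i =>
    (hzi i).trans_le (le_outD hP (hV i) _ _)
  have hQ : 0 < QV P V (fun i => (z i).2) := Finset.prod_pos fun i _ => hQi i
  have h1 : (n : ℝ) * (c + δ) < ∑ i, Real.log (V i (z i).1 (z i).2 / outD P (V i) (z i).2) := by
    rw [← Real.log_prod (fun i _ => (div_pos (hVi i) (hQi i)).ne'),
      Real.lt_log_iff_exp_lt (Finset.prod_pos fun i _ => div_pos (hVi i) (hQi i)),
      Finset.prod_div_distrib]
    exact (lt_div_iff₀ hQ).2 hlt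
  rw [Finset.sum_sub_distrib]
  have h2 : ∑ i, ∑ z : A × E, P z.1 * V i z.1 z.2 *
      Real.log (V i z.1 z.2 / outD P (V i) z.2) ≤ n * c := by
    calc _ ≤ ∑ i : Fin n, c := Finset.sum_le_sum fun i _ => by
          rw [← chanMI_eq hP (hV i)]; exact hc i
      _ = _ := by simp
  nlinarith

/-- Covering for a fixed channel tuple. -/
lemma cover_one {J : Type*} [Fintype J] [DecidableEq J] (S : Finset J) (hS : 0 < S.card)
    (hn : 0 < n) {P : A → ℝ} (hP : IsProbDist P) {V : Fin n → A → E → ℝ}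
    (hV : ∀ i, IsChannel (V i)) {c δ ε : ℝ} (hδ : 0 < δ) (hε : 0 < ε)
    (hc : ∀ i, chanMI P (V i) * Real.log 2 ≤ c) :
    PR (pw fun _ : J => pw fun _ : Fin n => P)
      (fun x => ¬ ∑ e, |(S.card : ℝ)⁻¹ * ∑ j ∈ S, WV V (x j) e - QV P V e| ≤
        2 * (ε + momC P / (n * δ ^ 2))) ≤
      Fintype.card (Fin n → E) * Real.exp (-(S.card * ε ^ 2 / (2 * Real.exp (n * (c + δ))))) := by
  classical
  set p := pw fun _ : Fin n => P with hpdef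
  have hp : IsProbDist p := pw_isProb fun _ => hP
  set τ := Real.exp (n * (c + δ)) with hτ
  have hτ0 : 0 < τ := Real.exp_pos _
  have hL : (0 : ℝ) < S.card := by exact_mod_cast hS
  set X : (Fin n → E) → (Fin n → A) → ℝ :=
    fun e y => if WV V y e ≤ τ * QV P V e then WV V y e else 0 with hX
  have hX0 : ∀ e y, 0 ≤ X e y := by
    intro e y; simp only [hX]; split_ifs
    · exact WV_nonneg hV _ _
    · exact le_rfl
  have hXW : ∀ e y, X e y ≤ WV V y e := by
    intro e y; simp only [hX]; split_ifs
    · exact le_rfl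
    · exact WV_nonneg hV _ _
  have hXb : ∀ e y, X e y ≤ τ * QV P V e := by
    intro e y; simp only [hX]; split_ifs with h
    · exact h
    · exact mul_nonneg hτ0.le (QV_nonneg hP hV e)
  have hμ : ∀ e, ∑ y, p y * X e y ≤ QV P V e := by
    intro e
    rw [QV_eq]
    exact Finset.sum_le_sum fun y _ => mul_le_mul_of_nonneg_left (hXW e y) (hp.1 y)
  have hw : ∀ x, 0 ≤ pw (fun _ : J => p) x := pw_nonneg fun _ => hp.1
  -- total truncated mass
  have htail : 1 - ∑ e, ∑ y, p y * X e y ≤ momC P / (n * δ ^ 2) := by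
    refine le_trans (le_of_eq ?_) (density_tail hn hP hV hδ hc)
    have h1 : (1 : ℝ) = ∑ e, ∑ y, p y * WV V y e := by
      simp_rw [hpdef, ← QV_eq]; exact (QV_sum hP hV).symm
    rw [h1, ← Finset.sum_sub_distrib]
    simp_rw [← Finset.sum_sub_distrib]
    rw [Finset.sum_comm, ← Fintype.sum_prod_type' (f := fun y e => p y * WV V y e - p y * X e y)]
    unfold PR
    refine (Fintype.sum_equiv (Equiv.arrowProdEquivProdArrow (Fin n) (fun _ => A) (fun _ => E))
      _ _ fun z => ?_).symm
    show _ = p (fun i => (z i).1) * WV V (fun i => (z i).1) (fun i => (z i).2) -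
      p (fun i => (z i).1) * X (fun i => (z i).2) (fun i => (z i).1)
    have hpw : pw (fun i => fun z : A × E => P z.1 * V i z.1 z.2) z =
        p (fun i => (z i).1) * WV V (fun i => (z i).1) (fun i => (z i).2) := by
      simp only [pw, hpdef, WV, Finset.prod_mul_distrib]
    rw [hpw]
    simp only [hX]
    split_ifs with h1 h2 h2
    · exact absurd h1 (not_lt.2 h2)
    · ring
    · ring
    · exact absurd (not_lt.1 h1) h2
  -- per-output bad events
  refine le_trans (PR_mono (C := fun x => ∃ e, QV P V e ≠ 0 ∧
    ∑ j ∈ S, X e (x j) ≤ S.card * (∑ y, p y * X e y - ε * QV P V e)) hw ?_) ?_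
  · intro x _ hbad
    by_contra hcon
    push Not at hcon
    apply hbad
    have hlow : ∀ e, ∑ y, p y * X e y - ε * QV P V e ≤
        (S.card : ℝ)⁻¹ * ∑ j ∈ S, WV V (x j) e := by
      intro e
      have h0 : ∑ j ∈ S, X e (x j) ≤ ∑ j ∈ S, WV V (x j) e :=
        Finset.sum_le_sum fun j _ => hXW e _
      rw [inv_mul_eq_div, le_div_iff₀ hL, mul_comm]
      refine le_trans ?_ h0
      by_cases hq : QV P V e = 0
      · have := hμ e
        rw [hq] at this ⊢
        have h1 : 0 ≤ ∑ j ∈ S, X e (x j) := Finset.sum_nonneg fun j _ => hX0 e _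
        nlinarith
      · exact (hcon e hq).le
    have hs1 : ∑ e, (S.card : ℝ)⁻¹ * ∑ j ∈ S, WV V (x j) e = 1 := by
      rw [← Finset.mul_sum, Finset.sum_comm]
      simp_rw [WV_sum hV]
      simp [hL.ne']
    calc _ ≤ ∑ e, (((S.card : ℝ)⁻¹ * ∑ j ∈ S, WV V (x j) e - QV P V e) +
          2 * (QV P V e - ∑ y, p y * X e y + ε * QV P V e)) := by
          refine Finset.sum_le_sum fun e _ => ?_
          have h1 := hlow e
          have h2 := hμ e
          have h3 := mul_nonneg hε.le (QV_nonneg hP hV e)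
          rw [abs_le]
          constructor <;> linarith
      _ = 2 * (ε + (1 - ∑ e, ∑ y, p y * X e y)) := by
          rw [Finset.sum_add_distrib, Finset.sum_sub_distrib, hs1, QV_sum hP hV, ← Finset.mul_sum,
            Finset.sum_add_distrib, Finset.sum_sub_distrib, ← Finset.mul_sum, QV_sum hP hV]
          ring
      _ ≤ _ := by linarith
  · refine PR_exists hw _ fun e => ?_
    by_cases hq : QV P V e = 0
    · have : PR (pw fun _ : J => p) (fun x => QV P V e ≠ 0 ∧
        ∑ j ∈ S, X e (x j) ≤ S.card * (∑ y, p y * X e y - ε * QV P V e)) = 0 := by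
        simp [PR, hq]
      rw [this]
      exact (Real.exp_pos _).le
    · have hq0 : 0 < QV P V e := lt_of_le_of_ne (QV_nonneg hP hV e) (Ne.symm hq)
      refine (PR_mono (C := fun x => ∑ j ∈ S, X e (x j) ≤
        S.card * (∑ y, p y * X e y - ε * QV P V e)) hw fun x _ h => h.2).trans ?_
      refine (chernoff hp S (X e) (b := τ * QV P V e) (q := QV P V e) (mul_pos hτ0 hq0) hε
        (hX0 e) (hXb e) (hμ e)).trans (le_of_eq ?_)
      congr 2
      field_simp

/-- Product distributions: total variation subadditivity. -/
lemma tv_prod {n : ℕ} (u v : Fin n → E → ℝ) (hu : ∀ i, IsProbDist (u i))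
    (hv : ∀ i, IsProbDist (v i)) :
    ∑ e : Fin n → E, |∏ i, u i (e i) - ∏ i, v i (e i)| ≤ ∑ i, ∑ e, |u i e - v i e| := by
  induction n with
  | zero => simp
  | succ n ih =>
    rw [← (Fin.consEquiv (fun _ : Fin (n + 1) => E)).sum_comp, Fintype.sum_prod_type,
      Fin.sum_univ_succ]
    have ih' := ih (fun i => u i.succ) (fun i => v i.succ) (fun i => hu _) (fun i => hv _)
    have hv1 : ∑ e : Fin n → E, ∏ i, v i.succ (e i) = 1 := by
      rw [sum_pi_prod (fun i e => v (Fin.succ i) e)]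
      simp [(hv _).2]
    calc _ ≤ ∑ a : E, ∑ e : Fin n → E, (|u 0 a - v 0 a| * ∏ i, v i.succ (e i) +
          u 0 a * |∏ i, u i.succ (e i) - ∏ i, v i.succ (e i)|) := by
          refine Finset.sum_le_sum fun a _ => Finset.sum_le_sum fun e _ => ?_
          simp only [Fin.consEquiv_apply, Fin.prod_univ_succ, Fin.cons_zero, Fin.cons_succ]
          have hv0 : 0 ≤ ∏ i, v (Fin.succ i) (e i) := Finset.prod_nonneg fun i _ => (hv _).1 _
          have e1 : u 0 a * ∏ i, u (Fin.succ i) (e i) - v 0 a * ∏ i, v (Fin.succ i) (e i) =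
            (u 0 a - v 0 a) * ∏ i, v (Fin.succ i) (e i) +
              u 0 a * (∏ i, u (Fin.succ i) (e i) - ∏ i, v (Fin.succ i) (e i)) := by ring
          rw [e1]
          refine (abs_add_le _ _).trans (le_of_eq ?_)
          rw [abs_mul, abs_mul, abs_of_nonneg hv0, abs_of_nonneg ((hu 0).1 a)]
      _ = ∑ a, |u 0 a - v 0 a| +
          ∑ e : Fin n → E, |∏ i, u i.succ (e i) - ∏ i, v i.succ (e i)| := by
          simp_rw [Finset.sum_add_distrib, ← Finset.mul_sum, hv1, mul_one]
          rw [← Finset.sum_mul, (hu 0).2, one_mul]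
      _ ≤ _ := by linarith

/-- Stability of the covering quantity. -/
lemma cover_stable {J : Type*} (S : Finset J) (hS : 0 < S.card) {P : A → ℝ} (hP : IsProbDist P)
    {V V' : Fin n → A → E → ℝ} (hV : ∀ i, IsChannel (V i)) (hV' : ∀ i, IsChannel (V' i))
    {r : ℝ} (hr : ∀ i a e, |V i a e - V' i a e| ≤ r) (x : J → Fin n → A) :
    ∑ e, |(S.card : ℝ)⁻¹ * ∑ j ∈ S, WV V (x j) e - QV P V e| ≤
      ∑ e, |(S.card : ℝ)⁻¹ * ∑ j ∈ S, WV V' (x j) e - QV P V' e|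
        + 2 * (n * (Fintype.card E * r)) := by
  have hL : (0 : ℝ) < S.card := by exact_mod_cast hS
  have h1 : ∀ y : Fin n → A, ∑ e, |WV V y e - WV V' y e| ≤ n * (Fintype.card E * r) := by
    intro y
    refine (tv_prod (fun i => V i (y i)) (fun i => V' i (y i))
      (fun i => ⟨(hV i).1 _, (hV i).2 _⟩) (fun i => ⟨(hV' i).1 _, (hV' i).2 _⟩)).trans ?_
    calc _ ≤ ∑ i : Fin n, ∑ e : E, r :=
          Finset.sum_le_sum fun i _ => Finset.sum_le_sum fun e _ => hr i _ e
      _ = _ := by simp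
  have h2 : ∑ e, |QV P V e - QV P V' e| ≤ n * (Fintype.card E * r) := by
    refine (tv_prod (fun i => outD P (V i)) (fun i => outD P (V' i))
      (fun i => ⟨outD_nonneg hP (hV i), outD_sum hP (hV i)⟩)
      (fun i => ⟨outD_nonneg hP (hV' i), outD_sum hP (hV' i)⟩)).trans ?_
    calc _ ≤ ∑ i : Fin n, ∑ e : E, r := by
          refine Finset.sum_le_sum fun i _ => Finset.sum_le_sum fun e _ => ?_
          unfold outD
          rw [← Finset.sum_sub_distrib]
          calc _ ≤ ∑ a, |P a * V i a e - P a * V' i a e| := Finset.abs_sum_le_sum_abs _ _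
            _ ≤ ∑ a, P a * r := by
              refine Finset.sum_le_sum fun a _ => ?_
              rw [← mul_sub, abs_mul, abs_of_nonneg (hP.1 a)]
              exact mul_le_mul_of_nonneg_left (hr i a e) (hP.1 a)
            _ = r := by rw [← Finset.sum_mul, hP.2, one_mul]
      _ = _ := by simp
  have h3 : ∑ e, |(S.card : ℝ)⁻¹ * ∑ j ∈ S, WV V (x j) e -
      (S.card : ℝ)⁻¹ * ∑ j ∈ S, WV V' (x j) e| ≤ n * (Fintype.card E * r) := by
    calc _ ≤ ∑ e, (S.card : ℝ)⁻¹ * ∑ j ∈ S, |WV V (x j) e - WV V' (x j) e| := by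
          refine Finset.sum_le_sum fun e _ => ?_
          rw [← mul_sub, ← Finset.sum_sub_distrib, abs_mul, abs_of_pos (inv_pos.2 hL)]
          exact mul_le_mul_of_nonneg_left (Finset.abs_sum_le_sum_abs _ _) (inv_pos.2 hL).le
      _ = (S.card : ℝ)⁻¹ * ∑ j ∈ S, ∑ e, |WV V (x j) e - WV V' (x j) e| := by
          rw [← Finset.mul_sum, Finset.sum_comm]
      _ ≤ (S.card : ℝ)⁻¹ * ∑ j ∈ S, (n * (Fintype.card E * r)) :=
          mul_le_mul_of_nonneg_left (Finset.sum_le_sum fun j _ => h1 _) (inv_pos.2 hL).le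
      _ = _ := by
          rw [Finset.sum_const, nsmul_eq_mul, ← mul_assoc, inv_mul_cancel₀ hL.ne', one_mul]
  calc _ ≤ ∑ e, (|(S.card : ℝ)⁻¹ * ∑ j ∈ S, WV V' (x j) e - QV P V' e| +
        |(S.card : ℝ)⁻¹ * ∑ j ∈ S, WV V (x j) e - (S.card : ℝ)⁻¹ * ∑ j ∈ S, WV V' (x j) e| +
        |QV P V e - QV P V' e|) := by
        refine Finset.sum_le_sum fun e _ => ?_
        have e1 : ∀ a b c d : ℝ, |a - b| ≤ |c - d| + |a - c| + |b - d| := by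
          intro a b c d
          have : a - b = (c - d) + (a - c) - (b - d) := by ring
          rw [this]
          exact (abs_sub _ _).trans (add_le_add_left (abs_add_le _ _) _)
        exact e1 _ _ _ _
    _ ≤ _ := by
        rw [Finset.sum_add_distrib, Finset.sum_add_distrib]
        linarith

/-- Covering, uniformly over all channel tuples from a family. -/
lemma cover_net {J : Type*} [Fintype J] [DecidableEq J] (S : Finset J) (hS : 0 < S.card)
    (hn : 0 < n) {P : A → ℝ} (hP : IsProbDist P) (𝒱 : Set (A → E → ℝ))
    (h𝒱 : ∀ V ∈ 𝒱, IsChannel V) {c δ ε : ℝ} (hδ : 0 < δ) (hε : 0 < ε)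
    (hc : ∀ V ∈ 𝒱, chanMI P V * Real.log 2 ≤ c) {m : ℕ} (hm : 0 < m) :
    PR (pw fun _ : J => pw fun _ : Fin n => P)
      (fun x => ∃ V : Fin n → A → E → ℝ, (∀ i, V i ∈ 𝒱) ∧
        ¬ ∑ e, |(S.card : ℝ)⁻¹ * ∑ j ∈ S, WV V (x j) e - QV P V e| ≤
        2 * (ε + momC P / (n * δ ^ 2)) + 2 * (n * (Fintype.card E * (1 / m)))) ≤
      ((m : ℝ) + 1) ^ (Fintype.card A * Fintype.card E * n) * (Fintype.card (Fin n → E) *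
        Real.exp (-(S.card * ε ^ 2 / (2 * Real.exp (n * (c + δ)))))) := by
  classical
  have hm' : (0 : ℝ) < m := by exact_mod_cast hm
  have hcard : ((m : ℝ) + 1) ^ (Fintype.card A * Fintype.card E * n) =
      Fintype.card (Fin n → A → E → Fin (m + 1)) := by
    simp only [Fintype.card_fun, Fintype.card_fin]
    push_cast
    rw [← pow_mul, ← pow_mul]
    congr 1
    ring
  rw [hcard]
  let cell : (A → E → ℝ) → (A → E → Fin (m + 1)) := fun V a e => Fin.ofNat (m + 1) ⌊V a e * m⌋₊
  have hcell : ∀ V ∈ 𝒱, ∀ a e, ((cell V a e : Fin (m + 1)) : ℕ) = ⌊V a e * m⌋₊ := by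
    intro V hVm a e
    have h1 : V a e ≤ 1 := by
      rw [← (h𝒱 V hVm).2 a]
      exact Finset.single_le_sum (f := fun e => V a e) (fun e _ => (h𝒱 V hVm).1 a e)
        (Finset.mem_univ e)
    have : ⌊V a e * m⌋₊ ≤ m := by
      apply Nat.floor_le_of_le
      nlinarith
    simp only [cell, Fin.ofNat]
    exact Nat.mod_eq_of_lt (by omega)
  have hclose : ∀ V ∈ 𝒱, ∀ V' ∈ 𝒱, cell V = cell V' → ∀ a e, |V a e - V' a e| ≤ 1 / m := by
    intro V hVm V' hVm' hcc a e
    have h1 : ⌊V a e * m⌋₊ = ⌊V' a e * m⌋₊ := by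
      rw [← hcell V hVm, ← hcell V' hVm', hcc]
    have a1 := Nat.floor_le (mul_nonneg ((h𝒱 V hVm).1 a e) hm'.le)
    have a2 := Nat.lt_floor_add_one (V a e * m)
    have b1 := Nat.floor_le (mul_nonneg ((h𝒱 V' hVm').1 a e) hm'.le)
    have b2 := Nat.lt_floor_add_one (V' a e * m)
    rw [h1] at a1 a2
    have : |(V a e - V' a e) * m| ≤ 1 := by rw [abs_le]; constructor <;> nlinarith
    rw [abs_mul, abs_of_pos hm'] at this
    rwa [le_div_iff₀ hm']
  let rep : (A → E → Fin (m + 1)) → (A → E → ℝ) := fun q =>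
    if h : ∃ V ∈ 𝒱, cell V = q then h.choose else 0
  have hrep : ∀ V ∈ 𝒱, rep (cell V) ∈ 𝒱 ∧ cell (rep (cell V)) = cell V := by
    intro V hVm
    have h : ∃ V' ∈ 𝒱, cell V' = cell V := ⟨V, hVm, rfl⟩
    simp only [rep, dif_pos h]
    exact h.choose_spec
  have hw : ∀ x, 0 ≤ pw (fun _ : J => pw fun _ : Fin n => P) x :=
    pw_nonneg fun _ => pw_nonneg fun _ => hP.1
  refine le_trans (PR_mono (C := fun x => ∃ t : Fin n → A → E → Fin (m + 1),
    (∀ i, rep (t i) ∈ 𝒱) ∧ ¬ ∑ e, |(S.card : ℝ)⁻¹ * ∑ j ∈ S, WV (fun i => rep (t i)) (x j) e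
      - QV P (fun i => rep (t i)) e| ≤ 2 * (ε + momC P / (n * δ ^ 2))) hw ?_) ?_
  · rintro x - ⟨V, hVm, hbad⟩
    refine ⟨fun i => cell (V i), fun i => (hrep _ (hVm i)).1, fun hgood => hbad ?_⟩
    refine (cover_stable S hS hP (fun i => h𝒱 _ (hVm i))
      (fun i => h𝒱 _ (hrep _ (hVm i)).1) (r := 1 / m) (fun i a e => ?_) x).trans
      (by linarith)
    exact hclose _ (hVm i) _ (hrep _ (hVm i)).1 (hrep _ (hVm i)).2.symm a e
  · refine PR_exists hw _ fun t => ?_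
    by_cases ht : ∀ i, rep (t i) ∈ 𝒱
    · refine (PR_mono hw fun x _ h => h.2).trans
        (cover_one S hS hn hP (fun i => h𝒱 _ (ht i)) hδ hε fun i => hc _ (ht i))
    · have : PR (pw fun _ : J => pw fun _ : Fin n => P) (fun x => (∀ i, rep (t i) ∈ 𝒱) ∧
          ¬ ∑ e, |(S.card : ℝ)⁻¹ * ∑ j ∈ S, WV (fun i => rep (t i)) (x j) e
          - QV P (fun i => rep (t i)) e| ≤ 2 * (ε + momC P / (n * δ ^ 2))) = 0 := by
        simp only [PR, ht, false_and, if_false, Finset.sum_const_zero]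
      rw [this]
      positivity

end

lemma count_eventually (C D : ℕ) {δ k ε : ℝ} (hδ : 0 < δ) (hk : 0 < k) (hε : 0 < ε) :
    ∀ᶠ n : ℕ in Filter.atTop,
      ((((n ^ 2 : ℕ) : ℝ) + 1) ^ (C * n)) * ((D : ℝ) ^ n * Real.exp (-(k * Real.exp (n * δ)))) ≤
        ε := by
  set k' := k * (δ ^ 3 / 6) with hk'
  have hk0 : 0 < k' := by positivity
  have h1 : ∀ᶠ n : ℕ in Filter.atTop, ((2 * C + D : ℝ) + 1) / k' ≤ n :=
    tendsto_natCast_atTop_atTop.eventually_ge_atTop _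
  have h2 : ∀ᶠ n : ℕ in Filter.atTop, Real.exp (-(n : ℝ)) ≤ ε := by
    have : Filter.Tendsto (fun n : ℕ => Real.exp (-(n : ℝ))) Filter.atTop (nhds 0) :=
      Real.tendsto_exp_neg_atTop_nhds_zero.comp tendsto_natCast_atTop_atTop
    exact this.eventually_le_const hε
  filter_upwards [h1, h2, Filter.eventually_ge_atTop 1] with n hn hn2 hn1
  refine le_trans ?_ hn2
  have hn1' : (1 : ℝ) ≤ n := by exact_mod_cast hn1
  have e1 : (((n ^ 2 : ℕ) : ℝ) + 1) ^ (C * n) ≤ Real.exp (2 * C * n ^ 2) := by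
    have : ((n ^ 2 : ℕ) : ℝ) + 1 ≤ Real.exp (2 * n) := by
      have a1 := Real.add_one_le_exp (n : ℝ)
      have a2 : Real.exp (2 * n) = Real.exp n ^ 2 := by rw [← Real.exp_nat_mul]; norm_num
      rw [a2]
      push_cast
      nlinarith
    calc _ ≤ Real.exp (2 * n) ^ (C * n) := pow_le_pow_left₀ (by positivity) this _
      _ = _ := by rw [← Real.exp_nat_mul]; congr 1; push_cast; ring
  have e2 : (D : ℝ) ^ n ≤ Real.exp (D * n ^ 2) := by
    have : (D : ℝ) ≤ Real.exp D := by linarith [Real.add_one_le_exp (D : ℝ)]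
    calc _ ≤ Real.exp D ^ n := pow_le_pow_left₀ (by positivity) this _
      _ = Real.exp (n * D) := by rw [← Real.exp_nat_mul]
      _ ≤ _ := by
        apply Real.exp_le_exp.2
        have : (0 : ℝ) ≤ D := by positivity
        nlinarith [mul_nonneg this (by linarith : (0 : ℝ) ≤ n), mul_nonneg (mul_nonneg this (by linarith : (0 : ℝ) ≤ n)) (by linarith : (0 : ℝ) ≤ n - 1)]
  have e3 : k' * n ^ 3 ≤ k * Real.exp (n * δ) := by
    have := Real.pow_div_factorial_le_exp (n * δ) (by positivity) 3
    have h6 : ((Nat.factorial 3 : ℕ) : ℝ) = 6 := by norm_num [Nat.factorial]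
    rw [h6] at this
    calc k' * n ^ 3 = k * ((n * δ) ^ 3 / 6) := by rw [hk']; ring
      _ ≤ _ := mul_le_mul_of_nonneg_left this hk.le
  have e4 : (2 * C + D + 1 : ℝ) ≤ k' * n := by
    rw [div_le_iff₀ hk0] at hn; linarith
  calc _ ≤ Real.exp (2 * C * n ^ 2) * (Real.exp (D * n ^ 2) * Real.exp (-(k' * n ^ 3))) := by
        gcongr
    _ = Real.exp ((2 * C + D) * n ^ 2 - k' * n ^ 3) := by
        rw [← Real.exp_add, ← Real.exp_add]; congr 1; ring
    _ ≤ _ := by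
        apply Real.exp_le_exp.2
        have : (2 * C + D + 1 : ℝ) * n ^ 2 ≤ k' * n * n ^ 2 :=
          mul_le_mul_of_nonneg_right e4 (by positivity)
        nlinarith

universe u

/-- Asymptotic uniform covering. -/
lemma cover_eventually {A E : Type*} [Fintype A] [Fintype E] {P : A → ℝ} (hP : IsProbDist P)
    (𝒱 : Set (A → E → ℝ)) (h𝒱 : ∀ V ∈ 𝒱, IsChannel V) {c δ ε : ℝ} (hδ : 0 < δ) (hε : 0 < ε)
    (hc : ∀ V ∈ 𝒱, chanMI P V * Real.log 2 ≤ c) :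
    ∀ᶠ n : ℕ in Filter.atTop, ∀ (J : Type u) [Fintype J] [DecidableEq J] (S : Finset J),
      Real.exp (n * (c + 2 * δ)) ≤ S.card →
      PR (pw fun _ : J => pw fun _ : Fin n => P)
        (fun x => ∃ V : Fin n → A → E → ℝ, (∀ i, V i ∈ 𝒱) ∧
          ¬ ∑ e, |(S.card : ℝ)⁻¹ * ∑ j ∈ S, WV V (x j) e - QV P V e| ≤ ε) ≤ ε := by
  set ε' := ε / 8 with hε'
  have hε0 : 0 < ε' := by positivity
  have hinv : Filter.Tendsto (fun n : ℕ => (n : ℝ)⁻¹) Filter.atTop (nhds 0) :=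
    tendsto_inv_atTop_zero.comp tendsto_natCast_atTop_atTop
  have h1 : ∀ᶠ n : ℕ in Filter.atTop, momC P / δ ^ 2 * (n : ℝ)⁻¹ ≤ ε' := by
    have := hinv.const_mul (momC P / δ ^ 2)
    rw [mul_zero] at this
    exact this.eventually_le_const hε0
  have h2 : ∀ᶠ n : ℕ in Filter.atTop, (Fintype.card E : ℝ) * (n : ℝ)⁻¹ ≤ ε' := by
    have := hinv.const_mul (Fintype.card E : ℝ)
    rw [mul_zero] at this
    exact this.eventually_le_const hε0
  filter_upwards [h1, h2, Filter.eventually_ge_atTop 1,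
    count_eventually (Fintype.card A * Fintype.card E) (Fintype.card E) hδ
      (k := ε' ^ 2 / 2) (by positivity) hε] with n a1 a2 a3 a4
  intro J _ _ S hS
  have hn0 : (0 : ℝ) < n := by exact_mod_cast a3
  have hL : (0 : ℝ) < S.card := (Real.exp_pos _).trans_le hS
  have hL' : 0 < S.card := by exact_mod_cast hL
  have hw : ∀ x, 0 ≤ pw (fun _ : J => pw fun _ : Fin n => P) x :=
    pw_nonneg fun _ => pw_nonneg fun _ => hP.1
  have hm : 0 < n ^ 2 := by positivity
  refine le_trans (PR_mono hw ?_) ((cover_net S hL' a3 hP 𝒱 h𝒱 hδ hε0 hc hm).trans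
    (le_trans ?_ a4))
  · rintro x - ⟨V, hV, hbad⟩
    refine ⟨V, hV, fun hgood => hbad (hgood.trans ?_)⟩
    have b1 : momC P / (n * δ ^ 2) ≤ ε' := by
      refine le_trans (le_of_eq ?_) a1
      field_simp
    have b2 : n * (Fintype.card E * (1 / ((n ^ 2 : ℕ) : ℝ))) ≤ ε' := by
      refine le_trans (le_of_eq ?_) a2
      push_cast
      field_simp
    linarith
  · rw [Fintype.card_fun, Fintype.card_fin]
    push_cast
    have : Real.exp (-(S.card * ε' ^ 2 / (2 * Real.exp (n * (c + δ))))) ≤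
        Real.exp (-(ε' ^ 2 / 2 * Real.exp (n * δ))) := by
      apply Real.exp_le_exp.2
      apply neg_le_neg
      rw [le_div_iff₀ (by positivity)]
      have e : Real.exp (n * (c + 2 * δ)) = Real.exp (n * δ) * Real.exp (n * (c + δ)) := by
        rw [← Real.exp_add]; congr 1; ring
      rw [e] at hS
      nlinarith [mul_le_mul_of_nonneg_right hS (sq_nonneg ε')]
    gcongr

/-! ### Sequential decoding -/

section
variable {ι : Type*} [Fintype ι] [DecidableEq ι]

/-- Orthogonal projection matrix. -/
def IsProjM (Q : Matrix ι ι ℂ) : Prop := Q.conjTranspose = Q ∧ Q * Q = Q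

/-- Real inner product of matrices. -/
def ipr (X Y : Matrix ι ι ℂ) : ℝ := (X.conjTranspose * Y).trace.re

/-- Squared Hilbert-Schmidt norm. -/
def nsq (X : Matrix ι ι ℂ) : ℝ := ipr X X

lemma ipr_comm (X Y : Matrix ι ι ℂ) : ipr X Y = ipr Y X := by
  unfold ipr
  have : (Y.conjTranspose * X) = (X.conjTranspose * Y).conjTranspose := by
    simp [Matrix.conjTranspose_mul]
  rw [this, Matrix.trace_conjTranspose]
  simp

lemma ipr_sub_right (X Y Z : Matrix ι ι ℂ) : ipr X (Y - Z) = ipr X Y - ipr X Z := by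
  simp [ipr, mul_sub, Matrix.trace_sub]

lemma ipr_sub_left (X Y Z : Matrix ι ι ℂ) : ipr (Y - Z) X = ipr Y X - ipr Z X := by
  rw [ipr_comm, ipr_sub_right, ipr_comm X, ipr_comm X]

lemma ipr_smul_right (r : ℝ) (X Y : Matrix ι ι ℂ) : ipr X ((r : ℂ) • Y) = r * ipr X Y := by
  simp [ipr, Matrix.trace_smul]

lemma nsq_nonneg (X : Matrix ι ι ℂ) : 0 ≤ nsq X := by
  have := (Matrix.posSemidef_conjTranspose_mul_self X).trace_nonneg
  exact (Complex.le_def.1 this).1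

lemma nsq_sub (X Y : Matrix ι ι ℂ) : nsq (X - Y) = nsq X - 2 * ipr X Y + nsq Y := by
  unfold nsq
  rw [ipr_sub_right, ipr_sub_left, ipr_sub_left, ipr_comm Y X]; ring

lemma ipr_amgm (X Y : Matrix ι ι ℂ) {η : ℝ} (hη : 0 < η) :
    ipr X Y ≤ nsq X / (2 * η) + η / 2 * nsq Y := by
  have h := nsq_nonneg (X - (η : ℂ) • Y)
  rw [nsq_sub, ipr_smul_right] at h
  have h2 : nsq ((η : ℂ) • Y) = η ^ 2 * nsq Y := by
    unfold nsq
    rw [ipr_smul_right, ipr_comm, ipr_smul_right]; ring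
  rw [h2] at h
  have h3 : nsq X / (2 * η) + η / 2 * nsq Y - ipr X Y =
      (nsq X - 2 * (η * ipr X Y) + η ^ 2 * nsq Y) / (2 * η) := by
    field_simp
    ring
  have h4 : 0 ≤ (nsq X - 2 * (η * ipr X Y) + η ^ 2 * nsq Y) / (2 * η) := by positivity
  linarith

lemma IsProjM.compl {Q : Matrix ι ι ℂ} (hQ : IsProjM Q) : IsProjM (1 - Q) := by
  refine ⟨by simp [Matrix.conjTranspose_sub, hQ.1], ?_⟩
  rw [mul_sub, sub_mul, mul_one, sub_mul, one_mul, hQ.2]; simp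

lemma IsProjM.ipr {Q : Matrix ι ι ℂ} (hQ : IsProjM Q) (X Y : Matrix ι ι ℂ) :
    ipr (Q * X) (Q * Y) = ipr X (Q * Y) := by
  unfold QKD.ipr
  rw [Matrix.conjTranspose_mul, hQ.1, Matrix.mul_assoc, ← Matrix.mul_assoc Q, hQ.2]

lemma IsProjM.nsq_add {Q : Matrix ι ι ℂ} (hQ : IsProjM Q) (X : Matrix ι ι ℂ) :
    nsq X = nsq (Q * X) + nsq ((1 - Q) * X) := by
  have h1 : nsq (Q * X) = QKD.ipr X (Q * X) := hQ.ipr X X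
  have h2 : nsq ((1 - Q) * X) = QKD.ipr X ((1 - Q) * X) := hQ.compl.ipr X X
  rw [h1, h2, sub_mul, one_mul, ipr_sub_right]
  unfold nsq; ring

lemma IsProjM.nsq_le {Q : Matrix ι ι ℂ} (hQ : IsProjM Q) (X : Matrix ι ι ℂ) :
    nsq (Q * X) ≤ nsq X := by
  rw [hQ.nsq_add X]; linarith [nsq_nonneg ((1 - Q) * X)]

lemma sen_step {Q : Matrix ι ι ℂ} (hQ : IsProjM Q) (v w : Matrix ι ι ℂ) {η S : ℝ} (hη : 0 < η)
    (h : nsq v - ipr v w ≤ S / (2 * η) + η / 2 * (nsq v - nsq w)) :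
    nsq v - ipr v (Q * w) ≤ (S + nsq ((1 - Q) * v)) / (2 * η) +
      η / 2 * (nsq v - nsq (Q * w)) := by
  have h1 : ipr v w - ipr v (Q * w) = ipr ((1 - Q) * v) ((1 - Q) * w) := by
    rw [hQ.compl.ipr, sub_mul, one_mul, ipr_sub_right]
  have h2 := ipr_amgm ((1 - Q) * v) ((1 - Q) * w) hη
  have h3 := hQ.nsq_add w
  rw [add_div]
  nlinarith

/-- Accumulated "no" operators. -/
def seqR (P0 : Matrix ι ι ℂ) (P : ℕ → Matrix ι ι ℂ) : ℕ → Matrix ι ι ℂ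
  | 0 => P0
  | j + 1 => (1 - P j) * seqR P0 P j

lemma seqR_sen (P0 : Matrix ι ι ℂ) {P : ℕ → Matrix ι ι ℂ} (hP : ∀ i, IsProjM (P i))
    (X : Matrix ι ι ℂ) {η : ℝ} (hη : 0 < η) (j : ℕ) :
    nsq (P0 * X) - ipr (P0 * X) (seqR P0 P j * X) ≤
      (∑ i ∈ Finset.range j, nsq (P i * (P0 * X))) / (2 * η) +
        η / 2 * (nsq (P0 * X) - nsq (seqR P0 P j * X)) := by
  induction j with
  | zero => simp [seqR, nsq]
  | succ j ih =>
    have := sen_step (hP j).compl (P0 * X) (seqR P0 P j * X) hη ih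
    rw [sub_sub_cancel] at this
    rw [Finset.sum_range_succ]
    simpa only [seqR, Matrix.mul_assoc] using this

lemma trace_psd_mul {M : Matrix ι ι ℂ} (R X : Matrix ι ι ℂ) (hM : IsProjM M) :
    ((R.conjTranspose * M * R) * (X * X.conjTranspose)).trace.re = nsq (M * (R * X)) := by
  unfold nsq ipr
  rw [Matrix.conjTranspose_mul, Matrix.conjTranspose_mul, hM.1]
  have : (R.conjTranspose * M * R) * (X * X.conjTranspose) =
    (R.conjTranspose * M * R * X) * X.conjTranspose := by simp only [Matrix.mul_assoc]
  rw [this, Matrix.trace_mul_comm]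
  congr 2
  simp only [Matrix.mul_assoc]
  rw [← Matrix.mul_assoc M M, hM.2]

lemma trace_proj_mul {M : Matrix ι ι ℂ} (X : Matrix ι ι ℂ) (hM : IsProjM M) :
    (M * (X * X.conjTranspose)).trace.re = nsq (M * X) := by
  have := trace_psd_mul 1 X hM
  simpa using this

lemma density_factor {ρ : Matrix ι ι ℂ} (h : ρ.PosSemidef) :
    ∃ X : Matrix ι ι ℂ, ρ = X * X.conjTranspose := by
  open scoped MatrixOrder in
  obtain ⟨B, hB⟩ := CStarAlgebra.nonneg_iff_eq_star_mul_self.1 h.nonneg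
  exact ⟨B.conjTranspose, by simpa [Matrix.star_eq_conjTranspose] using hB⟩

lemma seqR_bound {P0 : Matrix ι ι ℂ} (h0 : IsProjM P0) {P : ℕ → Matrix ι ι ℂ}
    (hP : ∀ i, IsProjM (P i)) (j : ℕ) {ρ : Matrix ι ι ℂ} (hρ : IsDensity ρ) {η : ℝ}
    (hη : 0 < η) :
    1 - (((seqR P0 P j).conjTranspose * P j * seqR P0 P j) * ρ).trace.re ≤
      ((1 - P0) * ρ).trace.re + η + 1 / η * (∑ i ∈ Finset.range j, (P i * (P0 * ρ * P0)).trace.re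
        + 2 * ((1 - P j) * ρ).trace.re + 2 * ((1 - P0) * ρ).trace.re) := by
  obtain ⟨X, rfl⟩ := density_factor hρ.1
  rw [trace_psd_mul _ _ (hP j), trace_proj_mul _ h0.compl, trace_proj_mul _ (hP j).compl]
  have e1 : ∀ i, (P i * (P0 * (X * X.conjTranspose) * P0)).trace.re = nsq (P i * (P0 * X)) := by
    intro i
    rw [← trace_proj_mul _ (hP i), Matrix.conjTranspose_mul, h0.1]
    simp only [Matrix.mul_assoc]
  simp_rw [e1]
  have hX : nsq X = 1 := by
    unfold nsq ipr
    rw [Matrix.trace_mul_comm, hρ.2]; simp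
  have hs := sen_step (hP j) (P0 * X) (seqR P0 P j * X) hη (seqR_sen P0 hP X hη j)
  set S := ∑ i ∈ Finset.range j, nsq (P i * (P0 * X))
  set w := P j * (seqR P0 P j * X)
  set v := P0 * X with hv
  have hv1 : nsq v = 1 - nsq ((1 - P0) * X) := by rw [← hX, h0.nsq_add X]; ring
  have hT : nsq ((1 - P j) * v) ≤ 2 * nsq ((1 - P j) * X) + 2 * nsq ((1 - P0) * X) := by
    have e : (1 - P j) * v = (1 - P j) * X - (1 - P j) * ((1 - P0) * X) := by
      rw [← mul_sub, hv]; congr 1; rw [sub_mul, one_mul]; abel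
    rw [e, nsq_sub]
    have h1 := (hP j).compl.nsq_le ((1 - P0) * X)
    have h2 : -(ipr ((1 - P j) * X) ((1 - P j) * ((1 - P0) * X))) ≤
        (nsq ((1 - P j) * X) + nsq ((1 - P j) * ((1 - P0) * X))) / 2 := by
      have a := nsq_nonneg ((1 - P j) * X - (-1 : ℝ) • ((1 - P j) * ((1 - P0) * X)))
      have b : ((-1 : ℝ) • ((1 - P j) * ((1 - P0) * X))) =
        (((-1 : ℝ) : ℂ) • ((1 - P j) * ((1 - P0) * X))) := by simp
      rw [b, nsq_sub, ipr_smul_right] at a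
      have c : nsq ((((-1 : ℝ) : ℂ) • ((1 - P j) * ((1 - P0) * X)))) =
          nsq ((1 - P j) * ((1 - P0) * X)) := by
        conv_lhs => unfold nsq
        rw [ipr_smul_right, ipr_comm, ipr_smul_right]; unfold nsq; ring
      rw [c] at a
      linarith
    linarith
  have hvw : 2 * ipr v w ≤ nsq v + nsq w := by
    have := nsq_nonneg (v - w); rw [nsq_sub] at this; linarith
  have hw0 := nsq_nonneg w
  have hv0 : nsq v ≤ 1 := by rw [hv1]; linarith [nsq_nonneg ((1 - P0) * X)]
  have h3 : nsq v - nsq w ≤ (S + nsq ((1 - P j) * v)) / η + η := by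
    have : (S + nsq ((1 - P j) * v)) / (2 * η) = (S + nsq ((1 - P j) * v)) / η / 2 := by
      field_simp
    rw [this] at hs
    have : η / 2 * (nsq v - nsq w) ≤ η / 2 * 1 :=
      mul_le_mul_of_nonneg_left (by linarith) (by positivity)
    linarith
  have h4 : (S + nsq ((1 - P j) * v)) / η ≤
      1 / η * (S + 2 * nsq ((1 - P j) * X) + 2 * nsq ((1 - P0) * X)) := by
    rw [one_div, inv_mul_eq_div]
    exact div_le_div_of_nonneg_right (by linarith) hη.le
  linarith

lemma IsProjM.posSemidef {Q : Matrix ι ι ℂ} (hQ : IsProjM Q) : Q.PosSemidef := by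
  have := Matrix.posSemidef_conjTranspose_mul_self Q
  rwa [hQ.1, hQ.2] at this

/-- The sequential decoder. -/
lemma seq_decoder {J : Type*} [Fintype J] [DecidableEq J] {P0 : Matrix ι ι ℂ} (h0 : IsProjM P0)
    {P : J → Matrix ι ι ℂ} (hP : ∀ i, IsProjM (P i)) :
    ∃ M : J → Matrix ι ι ℂ, (∀ j, (M j).PosSemidef) ∧ (1 - ∑ j, M j).PosSemidef ∧
      ∀ j (ρ : Matrix ι ι ℂ), IsDensity ρ → ∀ η : ℝ, 0 < η →
        1 - (M j * ρ).trace.re ≤ ((1 - P0) * ρ).trace.re + η +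
          1 / η * (∑ i ∈ Finset.univ.erase j, (P i * (P0 * ρ * P0)).trace.re
            + 2 * ((1 - P j) * ρ).trace.re + 2 * ((1 - P0) * ρ).trace.re) := by
  set N := Fintype.card J with hN
  let e : J ≃ Fin N := Fintype.equivFin J
  let P' : ℕ → Matrix ι ι ℂ := fun i => if h : i < N then P (e.symm ⟨i, h⟩) else 0
  have hP' : ∀ i, IsProjM (P' i) := by
    intro i
    simp only [P']
    split_ifs
    · exact hP _
    · exact ⟨by simp, by simp⟩
  have hPe : ∀ j, P' (e j) = P j := by intro j; simp [P']
  let M' : ℕ → Matrix ι ι ℂ := fun j => (seqR P0 P' j).conjTranspose * P' j * seqR P0 P' j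
  have hM' : ∀ j, (M' j).PosSemidef := fun j =>
    (hP' j).posSemidef.conjTranspose_mul_mul_same _
  have htel : ∀ m, ∑ i ∈ Finset.range m, M' i =
      P0 - (seqR P0 P' m).conjTranspose * seqR P0 P' m := by
    intro m
    induction m with
    | zero => simp [seqR, h0.1, h0.2]
    | succ m ih =>
      rw [Finset.sum_range_succ, ih]
      simp only [M', seqR]
      rw [Matrix.conjTranspose_mul, (hP' m).compl.1, Matrix.mul_assoc _ (1 - P' m),
        ← Matrix.mul_assoc (1 - P' m), (hP' m).compl.2, sub_mul, mul_sub, one_mul,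
        ← Matrix.mul_assoc]
      abel
  refine ⟨fun j => M' (e j), fun j => hM' _, ?_, ?_⟩
  · have : ∑ j, M' (e j) = ∑ i ∈ Finset.range N, M' i := by
      rw [Equiv.sum_comp e (fun i : Fin N => M' i), Finset.sum_range]
    rw [this, htel]
    have e2 : 1 - (P0 - (seqR P0 P' N).conjTranspose * seqR P0 P' N) =
      (1 - P0) + (seqR P0 P' N).conjTranspose * seqR P0 P' N := by abel
    rw [e2]
    exact h0.compl.posSemidef.add (Matrix.posSemidef_conjTranspose_mul_self _)
  · intro j ρ hρ η hη
    have h := seqR_bound h0 hP' (e j) hρ hη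
    rw [hPe] at h
    have hM : M' (e j) = (seqR P0 P' (e j)).conjTranspose * P j * seqR P0 P' (e j) := by
      simp only [M', hPe]
    show 1 - (M' (e j) * ρ).trace.re ≤ _
    rw [hM]
    refine h.trans ?_
    have hsum : ∑ i ∈ Finset.range (e j), (P' i * (P0 * ρ * P0)).trace.re ≤
        ∑ i ∈ Finset.univ.erase j, (P i * (P0 * ρ * P0)).trace.re := by
      have hnn : ∀ i, 0 ≤ (P i * (P0 * ρ * P0)).trace.re := by
        intro i
        obtain ⟨X, rfl⟩ := density_factor hρ.1
        have : P0 * (X * X.conjTranspose) * P0 = (P0 * X) * (P0 * X).conjTranspose := by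
          rw [Matrix.conjTranspose_mul, h0.1]; simp only [Matrix.mul_assoc]
        rw [this, trace_proj_mul _ (hP i)]
        exact nsq_nonneg _
      have : ∑ i ∈ Finset.range (e j), (P' i * (P0 * ρ * P0)).trace.re =
          ∑ i ∈ Finset.univ.filter (fun i => (e i : ℕ) < e j),
            (P i * (P0 * ρ * P0)).trace.re := by
        symm
        refine Finset.sum_bij (fun i _ => (e i : ℕ)) ?_ ?_ ?_ ?_
        · intro a ha; simpa using ha
        · intro a _ b _ hab; exact e.injective (Fin.ext hab)
        · intro b hb
          have hb' : b < e j := by simpa using hb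
          have hbN : b < N := hb'.trans (e j).2
          exact ⟨e.symm ⟨b, hbN⟩, by rw [Finset.mem_filter, Equiv.apply_symm_apply]; exact ⟨Finset.mem_univ _, hb'⟩, by simp⟩
        · intro a _; rw [hPe]
      rw [this]
      refine Finset.sum_le_sum_of_subset_of_nonneg ?_ fun i _ _ => hnn i
      intro i hi
      rw [Finset.mem_filter] at hi
      rw [Finset.mem_erase]
      exact ⟨fun h => by rw [h] at hi; exact lt_irrefl _ hi.2, Finset.mem_univ _⟩
    have : 0 < 1 / η := by positivity
    gcongr

end

/-! ### Tensor powers and typical projectors -/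

section
variable {A ι : Type*} [Fintype ι] {n : ℕ}

lemma tensPow_mul (ξ η : A → Matrix ι ι ℂ) (a : Fin n → A) :
    tensPow ξ a * tensPow η a = tensPow (fun a => ξ a * η a) a := by
  ext v w
  simp only [tensPow, Matrix.mul_apply, Matrix.of_apply, ← Finset.prod_mul_distrib]
  exact sum_pi_prod (fun j y => ξ (a j) (v j) y * η (a j) y (w j))

lemma tensPow_conjTranspose (ξ : A → Matrix ι ι ℂ) (a : Fin n → A) :
    (tensPow ξ a).conjTranspose = tensPow (fun a => (ξ a).conjTranspose) a := by
  ext v w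
  simp [tensPow, Matrix.conjTranspose_apply]

lemma tensPow_diagonal [DecidableEq ι] (D : A → ι → ℂ) (a : Fin n → A) :
    tensPow (fun a => Matrix.diagonal (D a)) a =
      Matrix.diagonal (fun v : Fin n → ι => ∏ i, D (a i) (v i)) := by
  ext v w
  by_cases h : v = w
  · subst h; simp [tensPow]
  · rw [Matrix.diagonal_apply_ne _ h]
    obtain ⟨i, hi⟩ := Function.ne_iff.1 h
    simp only [tensPow, Matrix.of_apply]
    exact Finset.prod_eq_zero (Finset.mem_univ i) (Matrix.diagonal_apply_ne _ hi)

lemma tensPow_one [DecidableEq ι] (a : Fin n → A) :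
    tensPow (fun _ => (1 : Matrix ι ι ℂ)) a = 1 := by
  have := tensPow_diagonal (fun (_ : A) (_ : ι) => (1 : ℂ)) a
  simpa using this

lemma tensPow_trace (ξ : A → Matrix ι ι ℂ) (a : Fin n → A) :
    (tensPow ξ a).trace = ∏ i, (ξ (a i)).trace := by
  simp only [tensPow, Matrix.trace, Matrix.diag_apply, Matrix.of_apply]
  exact sum_pi_prod (fun j y => ξ (a j) y y)

lemma tensPow_isDensity {ξ : A → Matrix ι ι ℂ} (h : ∀ a, IsDensity (ξ a)) (a : Fin n → A) :
    IsDensity (tensPow ξ a) := by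
  classical
  refine ⟨?_, ?_⟩
  · choose X hX using fun a => density_factor (h a).1
    have : tensPow ξ a = tensPow X a * (tensPow X a).conjTranspose := by
      rw [tensPow_conjTranspose, tensPow_mul]
      congr 1; funext a; exact hX a
    rw [this]
    exact Matrix.posSemidef_self_mul_conjTranspose _
  · rw [tensPow_trace]; simp [(h _).2]

lemma tensPow_exp [Fintype A] (P : A → ℝ) (ξ : A → Matrix ι ι ℂ) :
    ∑ x : Fin n → A, ((pw (fun _ => P) x : ℝ) : ℂ) • tensPow ξ x =
      tensPow (fun _ : Unit => ∑ a, (P a : ℂ) • ξ a) (fun _ => ()) := by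
  ext v w
  simp only [Matrix.sum_apply, Matrix.smul_apply, tensPow, Matrix.of_apply, pw, smul_eq_mul,
    Complex.ofReal_prod, ← Finset.prod_mul_distrib]
  exact sum_pi_prod (fun j y => (P y : ℂ) * ξ y (v j) (w j))

/-- Spectral data of a density matrix. -/
lemma spectral_data [DecidableEq ι] {ρ : Matrix ι ι ℂ} (h : IsDensity ρ) :
    ∃ (U : Matrix ι ι ℂ) (d : ι → ℝ), U * U.conjTranspose = 1 ∧ U.conjTranspose * U = 1 ∧
      ρ = U * Matrix.diagonal (fun i => (d i : ℂ)) * U.conjTranspose ∧ IsProbDist d ∧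
      ∑ i, Real.negMulLog (d i) = vnEntropy ρ * Real.log 2 := by
  have hH := h.1.1
  refine ⟨(hH.eigenvectorUnitary : Matrix ι ι ℂ), hH.eigenvalues, ?_, ?_, ?_, ⟨?_, ?_⟩, ?_⟩
  · rw [← Matrix.star_eq_conjTranspose]; simp
  · rw [← Matrix.star_eq_conjTranspose]; simp
  · conv_lhs => rw [hH.spectral_theorem]
    rw [Unitary.conjStarAlgAut_apply]
    rfl
  · exact h.1.eigenvalues_nonneg
  · have := hH.trace_eq_sum_eigenvalues
    rw [h.2] at this
    have h2 := congrArg Complex.re this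
    simpa using h2.symm
  · rw [vnEntropy, dif_pos hH, div_mul_cancel₀ _ log2_pos.ne']

end

section
variable {κ : Type*} [Fintype κ] [DecidableEq κ]

/-- Spectral projector. -/
def specP (T : Matrix κ κ ℂ) (p : κ → Prop) : Matrix κ κ ℂ :=
  open Classical in
  T * Matrix.diagonal (fun v => if p v then (1 : ℂ) else 0) * T.conjTranspose

lemma conj_mul {T : Matrix κ κ ℂ} (h : T.conjTranspose * T = 1) (X Y : Matrix κ κ ℂ) :
    (T * X * T.conjTranspose) * (T * Y * T.conjTranspose) = T * (X * Y) * T.conjTranspose := by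
  simp only [Matrix.mul_assoc]
  rw [← Matrix.mul_assoc T.conjTranspose T, h, Matrix.one_mul]

lemma specP_isProjM {T : Matrix κ κ ℂ} (h : T.conjTranspose * T = 1) (p : κ → Prop) :
    IsProjM (specP T p) := by
  classical
  refine ⟨?_, ?_⟩
  · unfold specP
    rw [Matrix.conjTranspose_mul, Matrix.conjTranspose_mul, Matrix.conjTranspose_conjTranspose,
      Matrix.diagonal_conjTranspose, ← Matrix.mul_assoc]
    congr 3
    funext v; simp only [Pi.star_apply]; split_ifs <;> simp
  · unfold specP
    rw [conj_mul h, Matrix.diagonal_mul_diagonal]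
    congr 3
    funext v; split_ifs <;> simp

lemma conj_trace {T : Matrix κ κ ℂ} (h : T.conjTranspose * T = 1) (X : Matrix κ κ ℂ) :
    (T * X * T.conjTranspose).trace = X.trace := by
  rw [Matrix.trace_mul_comm, ← Matrix.mul_assoc, h, Matrix.one_mul]

lemma specP_trace {T : Matrix κ κ ℂ} (h : T.conjTranspose * T = 1) {p : κ → Prop} {D : κ → ℝ}
    (hD : IsProbDist D) {s : ℝ} (hp : ∀ v, p v → Real.exp (-s) ≤ D v) :
    (specP T p).trace.re ≤ Real.exp s := by
  classical
  unfold specP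
  rw [conj_trace h, Matrix.trace_diagonal, Complex.re_sum]
  calc _ ≤ ∑ v, D v * Real.exp s := by
        refine Finset.sum_le_sum fun v _ => ?_
        split_ifs with hv
        · have := mul_le_mul_of_nonneg_right (hp v hv) (Real.exp_pos s).le
          rw [← Real.exp_add] at this
          simpa using this
        · simpa using mul_nonneg (hD.1 v) (Real.exp_pos s).le
    _ = _ := by rw [← Finset.sum_mul, hD.2, one_mul]

lemma specP_err {T : Matrix κ κ ℂ} (h : T.conjTranspose * T = 1) (h' : T * T.conjTranspose = 1)
    (p : κ → Prop) (D : κ → ℝ) :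
    ((1 - specP T p) * (T * Matrix.diagonal (fun v => (D v : ℂ)) * T.conjTranspose)).trace.re =
      PR D (fun v => ¬ p v) := by
  classical
  have e : 1 - specP T p =
      T * Matrix.diagonal (fun v => if p v then (0 : ℂ) else 1) * T.conjTranspose := by
    have : Matrix.diagonal (fun v => if p v then (0 : ℂ) else 1) =
        1 - Matrix.diagonal (fun v => if p v then (1 : ℂ) else 0) := by
      rw [← Matrix.diagonal_one, Matrix.diagonal_sub]
      congr 1; funext v; split_ifs <;> simp
    rw [this, mul_sub, sub_mul, mul_one, h']
    rfl
  rw [e, conj_mul h, conj_trace h, Matrix.diagonal_mul_diagonal, Matrix.trace_diagonal,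
    Complex.re_sum]
  unfold PR
  refine Finset.sum_congr rfl fun v _ => ?_
  by_cases hv : p v <;> simp [hv]

lemma trace_mul_nonneg {X Y : Matrix κ κ ℂ} (hX : X.PosSemidef) (hY : Y.PosSemidef) :
    0 ≤ (X * Y).trace.re := by
  obtain ⟨B, rfl⟩ := density_factor hX
  rw [Matrix.mul_assoc, Matrix.trace_mul_comm]
  have := (hY.conjTranspose_mul_mul_same B).trace_nonneg
  exact (Complex.le_def.1 this).1

lemma specP_bound {T : Matrix κ κ ℂ} (h : T.conjTranspose * T = 1) (h' : T * T.conjTranspose = 1)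
    {p : κ → Prop} {D : κ → ℝ} {c : ℝ} (hc : 0 ≤ c) (hp : ∀ v, p v → D v ≤ c)
    {Y : Matrix κ κ ℂ} (hY : Y.PosSemidef) :
    (Y * (specP T p * (T * Matrix.diagonal (fun v => (D v : ℂ)) * T.conjTranspose) *
      specP T p)).trace.re ≤ c * Y.trace.re := by
  classical
  have e : specP T p * (T * Matrix.diagonal (fun v => (D v : ℂ)) * T.conjTranspose) *
      specP T p = (c : ℂ) • (1 : Matrix κ κ ℂ) -
      T * Matrix.diagonal (fun v => (((c - if p v then D v else 0) : ℝ) : ℂ)) *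
        T.conjTranspose := by
    unfold specP
    rw [conj_mul h, conj_mul h, Matrix.diagonal_mul_diagonal, Matrix.diagonal_mul_diagonal]
    have : Matrix.diagonal (fun v => (((c - if p v then D v else 0) : ℝ) : ℂ)) =
        (c : ℂ) • (1 : Matrix κ κ ℂ) -
          Matrix.diagonal (fun v => (((if p v then D v else 0) : ℝ) : ℂ)) := by
      rw [← Matrix.diagonal_one, ← Matrix.diagonal_smul, Matrix.diagonal_sub]
      congr 1; funext v; simp
    rw [this, mul_sub, sub_mul, Matrix.mul_smul, Matrix.smul_mul, mul_one, h', sub_sub_cancel]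
    congr 3
    funext v; by_cases hv : p v <;> simp [hv]
  have hpsd : (T * Matrix.diagonal (fun v => (((c - if p v then D v else 0) : ℝ) : ℂ)) *
        T.conjTranspose).PosSemidef := by
    refine Matrix.PosSemidef.mul_mul_conjTranspose_same (Matrix.PosSemidef.diagonal ?_) T
    intro v
    simp only [Pi.zero_apply]
    rw [Complex.zero_le_real]
    split_ifs with hv
    · linarith [hp v hv]
    · linarith
  have := trace_mul_nonneg hY hpsd
  rw [e, mul_sub, Matrix.trace_sub, Complex.sub_re, Matrix.mul_smul, Matrix.trace_smul, mul_one]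
  simp only [smul_eq_mul, Complex.re_ofReal_mul]
  linarith

end

/-! ### Typicality estimates -/

section
variable {A ι : Type*} [Fintype A] [Fintype ι] [DecidableEq ι] {n : ℕ}

lemma pw_pos_factor {J Y : Type*} [Fintype J] {p : J → Y → ℝ} (hp : ∀ j y, 0 ≤ p j y)
    {x : J → Y} (h : 0 < pw p x) (j : J) : 0 < p j (x j) := by
  rcases (hp j (x j)).lt_or_eq with h1 | h1
  · exact h1
  · exfalso
    have : pw p x = 0 := Finset.prod_eq_zero (Finset.mem_univ j) h1.symm
    linarith

lemma typ_high (hn : 0 < n) {d : ι → ℝ} (hd : IsProbDist d) {δ : ℝ} (hδ : 0 < δ) :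
    PR (pw fun _ : Fin n => d)
      (fun v => ¬ pw (fun _ : Fin n => d) v ≤
        Real.exp (-(n * (∑ y, Real.negMulLog (d y) - δ)))) ≤
      (∑ y, d y * Real.log (d y) ^ 2) / (n * δ ^ 2) := by
  refine le_trans (PR_mono (pw_nonneg fun _ => hd.1) ?_)
    (chebyshev hn (p := fun _ => d) (fun _ => hd) (fun _ y => Real.log (d y)) hδ fun _ => le_rfl)
  intro v hv hb
  have hb' := not_le.1 hb
  have h1 := (Real.lt_log_iff_exp_lt hv).2 hb'
  have h2 : Real.log (pw (fun _ : Fin n => d) v) = ∑ i, Real.log (d (v i)) := by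
    unfold pw
    exact Real.log_prod fun i _ => (pw_pos_factor (fun _ => hd.1) hv i).ne'
  rw [h2] at h1
  have h3 : ∑ y, d y * Real.log (d y) = - ∑ y, Real.negMulLog (d y) := by
    rw [← Finset.sum_neg_distrib]
    exact Finset.sum_congr rfl fun y _ => by simp [Real.negMulLog]
  rw [Finset.sum_sub_distrib]
  simp only [Finset.sum_const, Finset.card_univ, Fintype.card_fin, nsmul_eq_mul, h3]
  linarith

lemma typ_low (hn : 0 < n) {P : A → ℝ} (hP : IsProbDist P) {d : A → ι → ℝ}
    (hd : ∀ a, IsProbDist (d a)) {δ : ℝ} (hδ : 0 < δ) :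
    ∑ x, pw (fun _ : Fin n => P) x * PR (pw fun i : Fin n => d (x i))
      (fun v => ¬ Real.exp (-(n * (∑ a, P a * ∑ y, Real.negMulLog (d a y) + δ))) ≤
        pw (fun i : Fin n => d (x i)) v) ≤
      (∑ z : A × ι, P z.1 * d z.1 z.2 * (-Real.log (d z.1 z.2)) ^ 2) / (n * δ ^ 2) := by
  classical
  set S := ∑ a, P a * ∑ y, Real.negMulLog (d a y) with hS
  have hq : IsProbDist (fun z : A × ι => P z.1 * d z.1 z.2) := by
    refine ⟨fun z => mul_nonneg (hP.1 _) ((hd _).1 _), ?_⟩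
    rw [Fintype.sum_prod_type]
    simp [← Finset.mul_sum, (hd _).2, hP.2]
  have key := chebyshev hn (p := fun _ => fun z : A × ι => P z.1 * d z.1 z.2) (fun _ => hq)
    (fun _ z => -Real.log (d z.1 z.2)) hδ fun _ => le_rfl
  refine le_trans ?_ key
  have hmean : ∑ z : A × ι, P z.1 * d z.1 z.2 * (-Real.log (d z.1 z.2)) = S := by
    rw [Fintype.sum_prod_type, hS]
    refine Finset.sum_congr rfl fun a _ => ?_
    rw [Finset.mul_sum]
    refine Finset.sum_congr rfl fun y _ => ?_
    simp only [Real.negMulLog]; ring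
  have e : ∑ x, pw (fun _ : Fin n => P) x * PR (pw fun i : Fin n => d (x i))
      (fun v => ¬ Real.exp (-(n * (S + δ))) ≤ pw (fun i : Fin n => d (x i)) v) =
      PR (pw fun _ : Fin n => fun z : A × ι => P z.1 * d z.1 z.2)
        (fun z => ¬ Real.exp (-(n * (S + δ))) ≤
          pw (fun i : Fin n => d (z i).1) (fun i => (z i).2)) := by
    unfold PR
    simp_rw [Finset.mul_sum]
    rw [← Fintype.sum_prod_type', ← Equiv.sum_comp (Equiv.arrowProdEquivProdArrow (Fin n)
      (fun _ => A) (fun _ => ι))]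
    refine Finset.sum_congr rfl fun z _ => ?_
    simp only [Equiv.arrowProdEquivProdArrow_apply, mul_ite, mul_zero]
    by_cases hz : Real.exp (-(n * (S + δ))) ≤
        pw (fun i : Fin n => d (z i).1) (fun i => (z i).2)
    · rw [if_neg (not_not_intro hz), if_neg (not_not_intro hz)]
    · rw [if_pos hz, if_pos hz]
      simp [pw, Finset.prod_mul_distrib]
  rw [e]
  refine PR_mono (pw_nonneg fun _ => hq.1) ?_
  intro z hz hb
  have hpos : ∀ i, 0 < d (z i).1 (z i).2 := by
    intro i
    have := pw_pos_factor (fun _ => hq.1) hz i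
    rcases ((hd (z i).1).1 (z i).2).lt_or_eq with h1 | h1
    · exact h1
    · simp [← h1] at this
  have hb' := not_le.1 hb
  have hpp : 0 < pw (fun i : Fin n => d (z i).1) (fun i => (z i).2) :=
    Finset.prod_pos fun i _ => hpos i
  have h1 := (Real.log_lt_iff_lt_exp hpp).2 hb'
  have h2 : Real.log (pw (fun i : Fin n => d (z i).1) (fun i => (z i).2)) =
      ∑ i, Real.log (d (z i).1 (z i).2) := by
    unfold pw
    exact Real.log_prod fun i _ => (hpos i).ne'
  rw [h2] at h1
  rw [Finset.sum_sub_distrib]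
  simp only [Finset.sum_const, Finset.card_univ, Fintype.card_fin, nsmul_eq_mul, hmean,
    Finset.sum_neg_distrib]
  linarith

lemma exp_trace (P : A → ℝ) (ρ : A → Matrix ι ι ℂ)
    (X Y : Matrix (Fin n → ι) (Fin n → ι) ℂ) :
    ∑ x, pw (fun _ : Fin n => P) x * (X * (Y * tensPow ρ x * Y)).trace.re =
      (X * (Y * tensPow (fun _ : Unit => ∑ a, (P a : ℂ) • ρ a) (fun _ => ()) * Y)).trace.re := by
  rw [← tensPow_exp]
  simp only [Matrix.mul_sum, Matrix.sum_mul, Matrix.trace_sum, Complex.re_sum, Matrix.mul_smul,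
    Matrix.smul_mul, Matrix.trace_smul, smul_eq_mul, Complex.re_ofReal_mul]

lemma mix_isDensity {P : A → ℝ} (hP : IsProbDist P) {ρ : A → Matrix ι ι ℂ}
    (hρ : ∀ a, IsDensity (ρ a)) : IsDensity (∑ a, (P a : ℂ) • ρ a) := by
  refine ⟨Matrix.posSemidef_sum _ fun a _ =>
    (hρ a).1.smul (Complex.zero_le_real.2 (hP.1 a)), ?_⟩
  rw [Matrix.trace_sum]
  simp only [Matrix.trace_smul, (hρ _).2, smul_eq_mul, mul_one]
  rw [← Complex.ofReal_sum, hP.2]; simp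

/-- The typical projectors. -/
lemma typ_proj {P : A → ℝ} (hP : IsProbDist P) {ρ : A → Matrix ι ι ℂ}
    (hρ : ∀ a, IsDensity (ρ a)) :
    ∃ C : ℝ, 0 ≤ C ∧ ∀ n : ℕ, 0 < n → ∀ δ : ℝ, 0 < δ →
      ∃ (P0 : Matrix (Fin n → ι) (Fin n → ι) ℂ)
        (Q : (Fin n → A) → Matrix (Fin n → ι) (Fin n → ι) ℂ),
        IsProjM P0 ∧ (∀ x, IsProjM (Q x)) ∧
        ∑ x, pw (fun _ : Fin n => P) x * ((1 - P0) * tensPow ρ x).trace.re ≤ C / (n * δ ^ 2) ∧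
        ∑ x, pw (fun _ : Fin n => P) x * ((1 - Q x) * tensPow ρ x).trace.re ≤ C / (n * δ ^ 2) ∧
        ∀ y, ∑ x, pw (fun _ : Fin n => P) x * (Q y * (P0 * tensPow ρ x * P0)).trace.re ≤
          Real.exp (-(n * (holevo P ρ * Real.log 2 - 2 * δ))) := by
  classical
  set σ := ∑ a, (P a : ℂ) • ρ a with hσ
  have hσd : IsDensity σ := mix_isDensity hP hρ
  obtain ⟨U0, d0, hU0, hU0', hσe, hd0, hH0⟩ := spectral_data hσd
  choose U d hU hU' hρe hd hH using fun a => spectral_data (hρ a)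
  set C0 := ∑ y, d0 y * Real.log (d0 y) ^ 2
  set C1 := ∑ z : A × ι, P z.1 * d z.1 z.2 * (-Real.log (d z.1 z.2)) ^ 2
  have hC0 : 0 ≤ C0 := Finset.sum_nonneg fun y _ => mul_nonneg (hd0.1 y) (sq_nonneg _)
  have hC1 : 0 ≤ C1 := Finset.sum_nonneg fun z _ =>
    mul_nonneg (mul_nonneg (hP.1 _) ((hd _).1 _)) (sq_nonneg _)
  refine ⟨C0 + C1, by positivity, ?_⟩
  intro n hn δ hδ
  have hnδ : 0 < (n : ℝ) * δ ^ 2 := by positivity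
  set H0 := ∑ y, Real.negMulLog (d0 y) with hH0d
  set S := ∑ a, P a * ∑ y, Real.negMulLog (d a y) with hSd
  let T0 : Matrix (Fin n → ι) (Fin n → ι) ℂ := tensPow (fun _ : Unit => U0) (fun _ => ())
  let T : (Fin n → A) → Matrix (Fin n → ι) (Fin n → ι) ℂ := fun x => tensPow U x
  have hT0 : T0 * T0.conjTranspose = 1 := by
    simp only [T0]
    rw [tensPow_conjTranspose, tensPow_mul, hU0, tensPow_one]
  have hT0' : T0.conjTranspose * T0 = 1 := by
    simp only [T0]
    rw [tensPow_conjTranspose, tensPow_mul, hU0', tensPow_one]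
  have hT : ∀ x, T x * (T x).conjTranspose = 1 := by
    intro x
    simp only [T]
    rw [tensPow_conjTranspose, tensPow_mul]
    simp only [hU]
    exact tensPow_one x
  have hT' : ∀ x, (T x).conjTranspose * T x = 1 := by
    intro x
    simp only [T]
    rw [tensPow_conjTranspose, tensPow_mul]
    simp only [hU']
    exact tensPow_one x
  have hσn : tensPow (fun _ : Unit => σ) (fun _ : Fin n => ()) =
      T0 * Matrix.diagonal (fun v => ((pw (fun _ : Fin n => d0) v : ℝ) : ℂ)) *
        T0.conjTranspose := by
    have := tensPow_diagonal (fun (_ : Unit) i => (d0 i : ℂ)) (fun _ : Fin n => ())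
    simp only [pw, Complex.ofReal_prod]
    rw [← this]
    simp only [T0]
    rw [tensPow_conjTranspose, tensPow_mul, tensPow_mul, ← hσe]
  have hρn : ∀ x, tensPow ρ x =
      T x * Matrix.diagonal (fun v => ((pw (fun i : Fin n => d (x i)) v : ℝ) : ℂ)) *
        (T x).conjTranspose := by
    intro x
    have := tensPow_diagonal (fun a i => (d a i : ℂ)) x
    simp only [pw, Complex.ofReal_prod]
    rw [← this]
    simp only [T]
    rw [tensPow_conjTranspose, tensPow_mul, tensPow_mul]
    congr 1
    funext a; exact hρe a
  let p0 : (Fin n → ι) → Prop := fun v => pw (fun _ : Fin n => d0) v ≤ Real.exp (-(n * (H0 - δ)))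
  let p1 : (Fin n → A) → (Fin n → ι) → Prop := fun x v =>
    Real.exp (-(n * (S + δ))) ≤ pw (fun i : Fin n => d (x i)) v
  refine ⟨specP T0 p0, fun x => specP (T x) (p1 x), specP_isProjM hT0' _,
    fun x => specP_isProjM (hT' x) _, ?_, ?_, ?_⟩
  · have e := exp_trace (n := n) P ρ (1 - specP T0 p0) 1
    simp only [Matrix.one_mul, Matrix.mul_one] at e
    rw [e, ← hσ, hσn, specP_err hT0' hT0]
    refine (typ_high hn hd0 hδ).trans ?_
    exact div_le_div_of_nonneg_right (by linarith) hnδ.le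
  · have e : ∀ x, ((1 - specP (T x) (p1 x)) * tensPow ρ x).trace.re =
        PR (pw (fun i : Fin n => d (x i))) (fun v => ¬ p1 x v) := by
      intro x
      rw [hρn, specP_err (hT' x) (hT x)]
    simp_rw [e]
    refine (typ_low hn hP hd hδ).trans ?_
    exact div_le_div_of_nonneg_right (by linarith) hnδ.le
  · intro y
    rw [exp_trace, ← hσ, hσn]
    refine (specP_bound hT0' hT0 (Real.exp_pos (-(n * (H0 - δ)))).le (fun v hv => hv)
      (specP_isProjM (hT' y) _).posSemidef).trans ?_
    have h1 := specP_trace (hT' y) (p := p1 y) (pw_isProb fun i => hd (y i)) (fun v hv => hv)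
    refine (mul_le_mul_of_nonneg_left h1 (Real.exp_pos _).le).trans ?_
    rw [← Real.exp_add]
    apply le_of_eq
    congr 1
    have : holevo P ρ * Real.log 2 = H0 - S := by
      unfold holevo
      rw [sub_mul, ← hσ, ← hH0, Finset.sum_mul, hSd]
      congr 1
      refine Finset.sum_congr rfl fun a _ => ?_
      rw [hH, mul_assoc]
    rw [this]; ring

/-- Expected error of Bob over a random codebook. -/
lemma bob_exp {P : A → ℝ} (hP : IsProbDist P) {ρ : A → Matrix ι ι ℂ}
    (hρ : ∀ a, IsDensity (ρ a)) :
    ∃ C : ℝ, 0 ≤ C ∧ ∀ n : ℕ, 0 < n → ∀ δ : ℝ, 0 < δ → ∀ (J : Type*) [Fintype J] [DecidableEq J],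
      ∃ M : (J → Fin n → A) → J → Matrix (Fin n → ι) (Fin n → ι) ℂ,
        (∀ x j, (M x j).PosSemidef) ∧ (∀ x, (1 - ∑ j, M x j).PosSemidef) ∧
        ∀ η : ℝ, 0 < η → ∀ j,
          ∑ x, pw (fun _ : J => pw fun _ : Fin n => P) x *
            (1 - (M x j * tensPow ρ (x j)).trace.re) ≤
          C / (n * δ ^ 2) + η + 1 / η * (Fintype.card J *
            Real.exp (-(n * (holevo P ρ * Real.log 2 - 2 * δ))) + 4 * (C / (n * δ ^ 2))) := by
  classical
  obtain ⟨C, hC, hT⟩ := typ_proj hP hρ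
  refine ⟨C, hC, ?_⟩
  intro n hn δ hδ J _ _
  obtain ⟨P0, Q, h0, hQ, hb0, hb1, hb2⟩ := hT n hn δ hδ
  choose M hM1 hM2 hM3 using fun x : J → Fin n → A =>
    seq_decoder (J := J) h0 (P := fun j => Q (x j)) (fun j => hQ _)
  refine ⟨M, hM1, hM2, ?_⟩
  intro η hη j
  set w := pw (fun _ : J => pw fun _ : Fin n => P) with hw
  have hpn : IsProbDist (pw fun _ : Fin n => P) := pw_isProb fun _ => hP
  have hwp : IsProbDist w := pw_isProb fun _ => hpn
  set t := C / (n * δ ^ 2)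
  set ε := Real.exp (-(n * (holevo P ρ * Real.log 2 - 2 * δ)))
  have hε : 0 ≤ ε := (Real.exp_pos _).le
  have hA : ∑ x, w x * ((1 - P0) * tensPow ρ (x j)).trace.re ≤ t := by
    rw [hw, pw_exp1 (fun _ => hpn.2) j (fun y => ((1 - P0) * tensPow ρ y).trace.re)]
    exact hb0
  have hB : ∑ x, w x * ((1 - Q (x j)) * tensPow ρ (x j)).trace.re ≤ t := by
    rw [hw, pw_exp1 (fun _ => hpn.2) j (fun y => ((1 - Q y) * tensPow ρ y).trace.re)]
    exact hb1
  have hI : ∀ i ∈ Finset.univ.erase j,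
      ∑ x, w x * (Q (x i) * (P0 * tensPow ρ (x j) * P0)).trace.re ≤ ε := by
    intro i hi
    rw [hw, pw_exp2 (fun _ => hpn.2) (Finset.ne_of_mem_erase hi)
      (fun y z => (Q y * (P0 * tensPow ρ z * P0)).trace.re)]
    calc _ ≤ ∑ y, (pw fun _ : Fin n => P) y * ε := by
          refine Finset.sum_le_sum fun y _ => ?_
          rw [← Finset.mul_sum]
          exact mul_le_mul_of_nonneg_left (hb2 y) (hpn.1 y)
      _ = ε := by rw [← Finset.sum_mul, hpn.2, one_mul]
  calc _ ≤ ∑ x, w x * (((1 - P0) * tensPow ρ (x j)).trace.re + η +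
          1 / η * (∑ i ∈ Finset.univ.erase j, (Q (x i) * (P0 * tensPow ρ (x j) * P0)).trace.re
            + 2 * ((1 - Q (x j)) * tensPow ρ (x j)).trace.re +
              2 * ((1 - P0) * tensPow ρ (x j)).trace.re)) := by
        refine Finset.sum_le_sum fun x _ => mul_le_mul_of_nonneg_left ?_ (hwp.1 x)
        exact hM3 x j _ (tensPow_isDensity hρ _) η hη
    _ = (∑ x, w x * ((1 - P0) * tensPow ρ (x j)).trace.re) + (∑ x, w x) * η +
          1 / η * ((∑ i ∈ Finset.univ.erase j,
            ∑ x, w x * (Q (x i) * (P0 * tensPow ρ (x j) * P0)).trace.re)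
            + 2 * (∑ x, w x * ((1 - Q (x j)) * tensPow ρ (x j)).trace.re) +
              2 * (∑ x, w x * ((1 - P0) * tensPow ρ (x j)).trace.re)) := by
        rw [Finset.sum_comm]
        simp only [Finset.mul_sum, Finset.sum_mul, ← Finset.sum_add_distrib]
        refine Finset.sum_congr rfl fun x _ => ?_
        rw [← Finset.mul_sum]
        ring
    _ ≤ _ := by
        rw [hwp.2, one_mul]
        have h1 : ∑ i ∈ Finset.univ.erase j,
            ∑ x, w x * (Q (x i) * (P0 * tensPow ρ (x j) * P0)).trace.re ≤
            Fintype.card J * ε := by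
          refine (Finset.sum_le_sum hI).trans ?_
          rw [Finset.sum_const, nsmul_eq_mul]
          refine mul_le_mul_of_nonneg_right ?_ hε
          exact_mod_cast Finset.card_le_univ _
        have h2 : 0 ≤ 1 / η := by positivity
        refine add_le_add (add_le_add hA le_rfl) ?_
        refine mul_le_mul_of_nonneg_left ?_ h2
        linarith
end

/-! ### Reductions for the joint distribution -/

section
variable {A : Type*} {dB dE n : ℕ}

/-- Product operator on the joint space. -/
def prodOp (X : Matrix (Fin n → Fin dB) (Fin n → Fin dB) ℂ)
    (Y : Matrix (Fin n → Fin dE) (Fin n → Fin dE) ℂ) :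
    Matrix (Fin n → Fin dB × Fin dE) (Fin n → Fin dB × Fin dE) ℂ :=
  Matrix.of fun v w => X (fun i => (v i).1) (fun i => (w i).1) *
    Y (fun i => (v i).2) (fun i => (w i).2)

lemma sum_arrow_prod (g : (Fin n → Fin dB × Fin dE) → ℂ) :
    ∑ v, g v = ∑ v1 : Fin n → Fin dB, ∑ v2 : Fin n → Fin dE, g (fun i => (v1 i, v2 i)) := by
  rw [← Fintype.sum_prod_type']
  rw [← Equiv.sum_comp (Equiv.arrowProdEquivProdArrow (Fin n)
      (fun _ => Fin dB) (fun _ => Fin dE)).symm]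
  rfl

lemma trace_prodOp (X : Matrix (Fin n → Fin dB) (Fin n → Fin dB) ℂ)
    (Y : Matrix (Fin n → Fin dE) (Fin n → Fin dE) ℂ)
    (ω : A → Matrix (Fin dB × Fin dE) (Fin dB × Fin dE) ℂ) (a : Fin n → A) :
    (prodOp X Y * tensPow ω a).trace =
      ∑ v1, ∑ v2, ∑ w1, ∑ w2, X v1 w1 * Y v2 w2 *
        ∏ i, ω (a i) (w1 i, w2 i) (v1 i, v2 i) := by
  simp only [Matrix.trace, Matrix.diag_apply, Matrix.mul_apply, prodOp, tensPow, Matrix.of_apply]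
  rw [sum_arrow_prod]
  refine Finset.sum_congr rfl fun v1 _ => Finset.sum_congr rfl fun v2 _ => ?_
  rw [sum_arrow_prod]

lemma trace_prodOp_one_right (X : Matrix (Fin n → Fin dB) (Fin n → Fin dB) ℂ)
    (ω : A → Matrix (Fin dB × Fin dE) (Fin dB × Fin dE) ℂ) (a : Fin n → A) :
    (prodOp X 1 * tensPow ω a).trace = (X * tensPow (fun a => ptraceE (ω a)) a).trace := by
  rw [trace_prodOp]
  simp only [Matrix.trace, Matrix.diag_apply, Matrix.mul_apply, tensPow, Matrix.of_apply,
    ptraceE]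
  refine Finset.sum_congr rfl fun v1 _ => ?_
  rw [Finset.sum_comm]
  refine Finset.sum_congr rfl fun w1 _ => ?_
  rw [← sum_pi_prod (fun (i : Fin n) e => ω (a i) (w1 i, e) (v1 i, e)), Finset.mul_sum]
  refine Finset.sum_congr rfl fun v2 _ => ?_
  simp [Matrix.one_apply]

lemma trace_prodOp_one_left (Y : Matrix (Fin n → Fin dE) (Fin n → Fin dE) ℂ)
    (ω : A → Matrix (Fin dB × Fin dE) (Fin dB × Fin dE) ℂ) (a : Fin n → A) :
    (prodOp 1 Y * tensPow ω a).trace = (Y * tensPow (fun a => ptraceB (ω a)) a).trace := by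
  rw [trace_prodOp]
  simp only [Matrix.trace, Matrix.diag_apply, Matrix.mul_apply, tensPow, Matrix.of_apply,
    ptraceB]
  rw [Finset.sum_comm]
  refine Finset.sum_congr rfl fun v2 _ => ?_
  have : ∀ v1 : Fin n → Fin dB, (∑ w1, ∑ w2, (1 : Matrix (Fin n → Fin dB) (Fin n → Fin dB) ℂ) v1 w1
      * Y v2 w2 * ∏ i, ω (a i) (w1 i, w2 i) (v1 i, v2 i)) =
      ∑ w2, Y v2 w2 * ∏ i, ω (a i) (v1 i, w2 i) (v1 i, v2 i) := by
    intro v1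
    rw [Finset.sum_comm]
    refine Finset.sum_congr rfl fun w2 _ => ?_
    simp [Matrix.one_apply]
  simp_rw [this]
  rw [Finset.sum_comm]
  refine Finset.sum_congr rfl fun w2 _ => ?_
  rw [← sum_pi_prod (fun (i : Fin n) b => ω (a i) (b, w2 i) (b, v2 i)), Finset.mul_sum]

/-- Product of single-site operators. -/
def siteOp {ι : Type*} (Z : Fin n → Matrix ι ι ℂ) : Matrix (Fin n → ι) (Fin n → ι) ℂ :=
  Matrix.of fun v w => ∏ i, Z i (v i) (w i)

lemma siteOp_sum {E ι : Type*} [Fintype E] [Fintype ι] [DecidableEq ι]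
    {Mi : Fin n → E → Matrix ι ι ℂ} (h : ∀ i, ∑ e, Mi i e = 1) :
    ∑ e : Fin n → E, siteOp (fun i => Mi i (e i)) = 1 := by
  rw [← tensPow_one (A := Unit) (fun _ => ())]
  ext v w
  simp only [Matrix.sum_apply, siteOp, Matrix.of_apply, tensPow]
  rw [sum_pi_prod (fun i e => Mi i e (v i) (w i))]
  refine Finset.prod_congr rfl fun i _ => ?_
  rw [← Matrix.sum_apply, h]

lemma siteOp_trace {ι : Type*} [Fintype ι] (Z : Fin n → Matrix ι ι ℂ) (ω : A → Matrix ι ι ℂ)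
    (a : Fin n → A) : (siteOp Z * tensPow ω a).trace = ∏ i, (Z i * ω (a i)).trace := by
  simp only [Matrix.trace, Matrix.diag_apply, Matrix.mul_apply, tensPow, Matrix.of_apply, siteOp,
    ← Finset.prod_mul_distrib]
  rw [← sum_pi_prod (fun (i : Fin n) v => ∑ w, Z i v w * ω (a i) w v)]
  refine Finset.sum_congr rfl fun v _ => ?_
  exact sum_pi_prod (fun (i : Fin n) w => Z i (v i) w * ω (a i) w (v i))

lemma trace_real {ι : Type*} [Fintype ι] {X Y : Matrix ι ι ℂ} (hX : X.PosSemidef)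
    (hY : Y.PosSemidef) : (X * Y).trace = ((X * Y).trace.re : ℂ) := by
  classical
  obtain ⟨B, rfl⟩ := density_factor hX
  rw [Matrix.mul_assoc, Matrix.trace_mul_comm]
  have := (hY.conjTranspose_mul_mul_same B).trace_nonneg
  exact Complex.eq_re_of_ofReal_le this

lemma prodOp_sum_right {T : Type*} [Fintype T] (X : Matrix (Fin n → Fin dB) (Fin n → Fin dB) ℂ)
    (Y : T → Matrix (Fin n → Fin dE) (Fin n → Fin dE) ℂ)
    (R : Matrix (Fin n → Fin dB × Fin dE) (Fin n → Fin dB × Fin dE) ℂ) :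
    ∑ t, (prodOp X (Y t) * R).trace.re = (prodOp X (∑ t, Y t) * R).trace.re := by
  rw [← Complex.re_sum, ← Matrix.trace_sum, ← Matrix.sum_mul]
  congr 4
  ext v w
  simp [prodOp, Matrix.sum_apply, Finset.mul_sum]

lemma prodOp_sum_left {T : Type*} [Fintype T] (X : T → Matrix (Fin n → Fin dB) (Fin n → Fin dB) ℂ)
    (Y : Matrix (Fin n → Fin dE) (Fin n → Fin dE) ℂ)
    (R : Matrix (Fin n → Fin dB × Fin dE) (Fin n → Fin dB × Fin dE) ℂ) :
    ∑ t, (prodOp (X t) Y * R).trace.re = (prodOp (∑ t, X t) Y * R).trace.re := by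
  rw [← Complex.re_sum, ← Matrix.trace_sum, ← Matrix.sum_mul]
  congr 4
  ext v w
  simp [prodOp, Matrix.sum_apply, Finset.sum_mul]

variable {K E : Type*} [Fintype K] [Fintype A] [Fintype E] [DecidableEq K] {dA : ℕ}

lemma qkdJoint_bob
    (Θ : Matrix (Fin dA) (Fin dA) ℂ →ₗ[ℂ] Matrix (Fin dB × Fin dE) (Fin dB × Fin dE) ℂ)
    (ξ : A → Matrix (Fin dA) (Fin dA) ℂ) (F : K → (Fin n → A) → ℝ)
    (MB : K → Matrix (Fin n → Fin dB) (Fin n → Fin dB) ℂ)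
    (Mi : Fin n → E → Matrix (Fin dE) (Fin dE) ℂ) (f : (Fin n → E) → K)
    (hM : ∀ i, IsPOVM (Mi i)) (k kB : K) :
    ∑ kE, qkdJoint Θ ξ F MB Mi f k kB kE = (Fintype.card K : ℝ)⁻¹ * ∑ a, F k a *
      (MB kB * tensPow (fun a => ptraceE (Θ (ξ a))) a).trace.re := by
  unfold qkdJoint
  rw [← Finset.mul_sum, Finset.sum_comm]
  congr 1
  refine Finset.sum_congr rfl fun a _ => ?_
  rw [← Finset.mul_sum, Finset.sum_comm]
  congr 1
  simp only [Finset.sum_ite_eq, Finset.mem_univ, if_true]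
  refine (prodOp_sum_right (MB kB) (fun e : Fin n → E => siteOp (fun i => Mi i (e i)))
    (tensPow (fun a' => Θ (ξ a')) a)).trans ?_
  rw [siteOp_sum fun i => (hM i).2, trace_prodOp_one_right]

lemma qkdJoint_eve
    (Θ : Matrix (Fin dA) (Fin dA) ℂ →ₗ[ℂ] Matrix (Fin dB × Fin dE) (Fin dB × Fin dE) ℂ)
    (ξ : A → Matrix (Fin dA) (Fin dA) ℂ) (F : K → (Fin n → A) → ℝ)
    (MB : K → Matrix (Fin n → Fin dB) (Fin n → Fin dB) ℂ)
    (Mi : Fin n → E → Matrix (Fin dE) (Fin dE) ℂ) (f : (Fin n → E) → K)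
    (hB : IsPOVM MB) (hM : ∀ i, IsPOVM (Mi i)) (hE : ∀ a, IsDensity (ptraceB (Θ (ξ a))))
    (k kE : K) :
    ∑ kB, qkdJoint Θ ξ F MB Mi f k kB kE = (Fintype.card K : ℝ)⁻¹ * ∑ a, F k a *
      ∑ e : Fin n → E, if f e = kE then
        WV (fun i a e => measProb (Mi i) (ptraceB (Θ (ξ a))) e) a e else 0 := by
  unfold qkdJoint
  rw [← Finset.mul_sum, Finset.sum_comm]
  congr 1
  refine Finset.sum_congr rfl fun a _ => ?_
  rw [← Finset.mul_sum, Finset.sum_comm]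
  congr 1
  refine Finset.sum_congr rfl fun e _ => ?_
  by_cases he : f e = kE
  · simp only [he, if_true]
    refine (prodOp_sum_left MB (siteOp (fun i => Mi i (e i)))
      (tensPow (fun a' => Θ (ξ a')) a)).trans ?_
    rw [hB.2, trace_prodOp_one_left, siteOp_trace]
    rw [Finset.prod_congr rfl fun i _ => trace_real ((hM i).1 (e i)) (hE (a i)).1]
    rw [← Complex.ofReal_prod, Complex.ofReal_re]
    rfl
  · simp [he]

lemma cptp_density
    {Θ : Matrix (Fin dA) (Fin dA) ℂ →ₗ[ℂ] Matrix (Fin dB × Fin dE) (Fin dB × Fin dE) ℂ}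
    (hΘ : IsCPTP Θ) {ρ : Matrix (Fin dA) (Fin dA) ℂ} (hρ : IsDensity ρ) : IsDensity (Θ ρ) := by
  refine ⟨?_, by rw [hΘ.2, hρ.2]⟩
  have h := hΘ.1 1 (ρ.submatrix Prod.fst Prod.fst) (hρ.1.submatrix _)
  exact h.submatrix (fun k => (k, (0 : Fin 1)))

lemma ptraceE_density {ω : Matrix (Fin dB × Fin dE) (Fin dB × Fin dE) ℂ} (h : IsDensity ω) :
    IsDensity (ptraceE ω) := by
  refine ⟨?_, ?_⟩
  · have : ptraceE ω = ∑ e, ω.submatrix (fun i => (i, e)) (fun i => (i, e)) := by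
      ext i j; simp [ptraceE, Matrix.sum_apply]
    rw [this]
    exact Matrix.posSemidef_sum _ fun e _ => h.1.submatrix _
  · rw [← h.2]
    simp only [Matrix.trace, ptraceE, Matrix.diag_apply, Matrix.of_apply, Fintype.sum_prod_type]

lemma ptraceB_density {ω : Matrix (Fin dB × Fin dE) (Fin dB × Fin dE) ℂ} (h : IsDensity ω) :
    IsDensity (ptraceB ω) := by
  refine ⟨?_, ?_⟩
  · have : ptraceB ω = ∑ e, ω.submatrix (fun i => (e, i)) (fun i => (e, i)) := by
      ext i j; simp [ptraceB, Matrix.sum_apply]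
    rw [this]
    exact Matrix.posSemidef_sum _ fun e _ => h.1.submatrix _
  · rw [← h.2]
    simp only [Matrix.trace, ptraceB, Matrix.diag_apply, Matrix.of_apply,
      Fintype.sum_prod_type_right]

end

section
variable {A ι : Type*} [Fintype A] [Fintype ι] [DecidableEq ι]

lemma measProb_channel {B : Type*} [Fintype B] {M : B → Matrix ι ι ℂ} (hM : IsPOVM M)
    {ω : A → Matrix ι ι ℂ} (hω : ∀ a, IsDensity (ω a)) :
    IsChannel (fun a b => measProb M (ω a) b) := by
  refine ⟨fun a b => trace_mul_nonneg (hM.1 b) (hω a).1, fun a => ?_⟩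
  unfold measProb
  rw [← Complex.re_sum, ← Matrix.trace_sum, ← Matrix.sum_mul, hM.2, Matrix.one_mul, (hω a).2]
  simp

lemma measMI_joint {B : Type*} [Fintype B] {P : A → ℝ} (hP : IsProbDist P)
    {M : B → Matrix ι ι ℂ} (hM : IsPOVM M)
    {ω : A → Matrix ι ι ℂ} (hω : ∀ a, IsDensity (ω a)) :
    (∀ a b, 0 ≤ P a * measProb M (ω a) b) ∧ ∑ a, ∑ b, P a * measProb M (ω a) b = 1 := by
  have h := measProb_channel hM hω
  refine ⟨fun a b => mul_nonneg (hP.1 a) (h.1 a b), ?_⟩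
  simp only [← Finset.mul_sum, h.2, mul_one, hP.2]

lemma miJoint_reindex {B B' : Type*} [Fintype B] [Fintype B'] (J : A → B → ℝ) (e : B' ≃ B) :
    miJoint (fun a b => J a (e b)) = miJoint J := by
  unfold miJoint entropy
  have h1 : (fun a => ∑ b, J a (e b)) = fun a => ∑ b, J a b := by
    funext a; exact Equiv.sum_comp e (J a)
  have h2 : ∑ b, Real.negMulLog (∑ a, J a (e b)) = ∑ b, Real.negMulLog (∑ a, J a b) :=
    Equiv.sum_comp e (fun b => Real.negMulLog (∑ a, J a b))
  have h3 : ∑ p : A × B', Real.negMulLog (J p.1 (e p.2)) =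
      ∑ p : A × B, Real.negMulLog (J p.1 p.2) := by
    rw [Fintype.sum_prod_type, Fintype.sum_prod_type]
    exact Finset.sum_congr rfl fun a _ => Equiv.sum_comp e (fun b => Real.negMulLog (J a b))
  simp only [h2, h3]
  simp only [Equiv.sum_comp e (J _)]

lemma accInfo_bdd {ω : A → Matrix ι ι ℂ} (hω : ∀ a, IsDensity (ω a)) :
    BddAbove (accInfoSet ω) := by
  refine ⟨Fintype.card A / Real.log 2, ?_⟩
  rintro _ ⟨P, m, M, hP, hM, rfl⟩
  rw [le_div_iff₀ log2_pos]
  exact miJoint_le_card (measMI_joint hP hM hω).1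

lemma chanMI_le_acc {B : Type*} [Fintype B] {P : A → ℝ} (hP : IsProbDist P)
    {M : B → Matrix ι ι ℂ} (hM : IsPOVM M)
    {ω : A → Matrix ι ι ℂ} (hω : ∀ a, IsDensity (ω a)) :
    chanMI P (fun a b => measProb M (ω a) b) ≤ sSup (accInfoSet ω) := by
  refine le_csSup (accInfo_bdd hω) ?_
  let e := (Fintype.equivFin B).symm
  refine ⟨P, Fintype.card B, fun i => M (e i), hP, ⟨fun b => hM.1 _, ?_⟩, ?_⟩
  · rw [← hM.2]; exact Equiv.sum_comp e M
  · exact (miJoint_reindex (fun a b => P a * measProb M (ω a) b) e).symm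

lemma acc_nonneg [Nonempty A] {ω : A → Matrix ι ι ℂ} (hω : ∀ a, IsDensity (ω a)) {P : A → ℝ}
    (hP : IsProbDist P) : 0 ≤ sSup (accInfoSet ω) := by
  have hM : IsPOVM (fun _ : Unit => (1 : Matrix ι ι ℂ)) :=
    ⟨fun _ => Matrix.PosSemidef.one, by simp⟩
  refine le_trans ?_ (chanMI_le_acc hP hM hω)
  exact miJoint_nonneg (measMI_joint hP hM hω).1 (measMI_joint hP hM hω).2
end

/-! ### Assembly -/

lemma bob_limit (C δ η κ D : ℝ) (hD : 0 < D) (hη : 0 < η) :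
    ∀ᶠ n : ℕ in Filter.atTop, C / (n * δ ^ 2) + η + 1 / η *
      (κ * Real.exp (-(n * D)) + 4 * (C / (n * δ ^ 2))) < 2 * η := by
  have h1 : Filter.Tendsto (fun n : ℕ => C / (n * δ ^ 2)) Filter.atTop (nhds 0) := by
    have := (tendsto_const_div_atTop_nhds_zero_nat (C / δ ^ 2))
    refine this.congr fun n => ?_
    rw [div_div, mul_comm]
  have h2 : Filter.Tendsto (fun n : ℕ => Real.exp (-(n * D))) Filter.atTop (nhds 0) := by
    refine Real.tendsto_exp_neg_atTop_nhds_zero.comp ?_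
    exact Filter.Tendsto.atTop_mul_const hD tendsto_natCast_atTop_atTop
  have h3 := (h1.add_const η).add (((h2.const_mul κ).add (h1.const_mul 4)).const_mul (1 / η))
  have h4 := h3.eventually (gt_mem_nhds (show 0 + η + 1 / η * (κ * 0 + 4 * 0) < 2 * η by
    simp; linarith))
  exact h4

section
variable {K A E : Type*} [Fintype K] [Fintype A] [Fintype E] [DecidableEq K]

/-- The random coder associated with a codebook. -/
def coder {n L : ℕ} (x : K × Fin L → Fin n → A) (k : K) (a : Fin n → A) : ℝ :=
  open Classical in
  (L : ℝ)⁻¹ * ∑ l, if x (k, l) = a then 1 else 0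

lemma coder_sum {n L : ℕ} (x : K × Fin L → Fin n → A) (k : K) (g : (Fin n → A) → ℝ) :
    ∑ a, coder x k a * g a = (L : ℝ)⁻¹ * ∑ l, g (x (k, l)) := by
  classical
  unfold coder
  simp_rw [mul_assoc]
  rw [← Finset.mul_sum]
  congr 1
  simp_rw [Finset.sum_mul]
  rw [Finset.sum_comm]
  refine Finset.sum_congr rfl fun l _ => ?_
  simp

lemma coder_channel {n L : ℕ} (hL : 0 < L) (x : K × Fin L → Fin n → A) :
    IsChannel (coder x) := by
  classical
  refine ⟨fun k a => ?_, fun k => ?_⟩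
  · unfold coder
    refine mul_nonneg (by positivity) (Finset.sum_nonneg fun l _ => ?_)
    split_ifs <;> norm_num
  · have := coder_sum x k (fun _ => 1)
    simp only [mul_one] at this
    rw [this]
    have : (L : ℝ) ≠ 0 := by positivity
    simp [this]

/-- Bob's observable obtained from the decoder. -/
def bobM {κ : Type*} [Fintype κ] [DecidableEq κ] {L : ℕ} (M : K × Fin L → Matrix κ κ ℂ)
    (k0 k : K) : Matrix κ κ ℂ :=
  ∑ l, M (k, l) + if k = k0 then 1 - ∑ j, M j else 0

lemma bobM_povm {κ : Type*} [Fintype κ] [DecidableEq κ] {L : ℕ} {M : K × Fin L → Matrix κ κ ℂ}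
    (h1 : ∀ j, (M j).PosSemidef) (h2 : (1 - ∑ j, M j).PosSemidef) (k0 : K) :
    IsPOVM (bobM M k0) := by
  refine ⟨fun k => ?_, ?_⟩
  · unfold bobM
    refine (Matrix.posSemidef_sum _ fun l _ => h1 _).add ?_
    split_ifs
    · exact h2
    · exact Matrix.PosSemidef.zero
  · unfold bobM
    rw [Finset.sum_add_distrib, ← Fintype.sum_prod_type']
    simp

lemma bobM_ge {κ : Type*} [Fintype κ] [DecidableEq κ] {L : ℕ} {M : K × Fin L → Matrix κ κ ℂ}
    (h1 : ∀ j, (M j).PosSemidef) (h2 : (1 - ∑ j, M j).PosSemidef) (k0 k : K) (l : Fin L)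
    {ρ : Matrix κ κ ℂ} (hρ : ρ.PosSemidef) :
    (M (k, l) * ρ).trace.re ≤ (bobM M k0 k * ρ).trace.re := by
  have e : bobM M k0 k = M (k, l) + (∑ l ∈ Finset.univ.erase l, M (k, l) +
      if k = k0 then 1 - ∑ j, M j else 0) := by
    unfold bobM
    rw [← Finset.add_sum_erase _ _ (Finset.mem_univ l), add_assoc]
  have hp : (∑ l ∈ Finset.univ.erase l, M (k, l) +
      if k = k0 then 1 - ∑ j, M j else 0).PosSemidef := by
    refine (Matrix.posSemidef_sum _ fun l _ => h1 _).add ?_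
    split_ifs
    · exact h2
    · exact Matrix.PosSemidef.zero
  rw [e, add_mul, Matrix.trace_add, Complex.add_re]
  linarith [trace_mul_nonneg hp hρ]

lemma sub_prob {κ J : Type*} [Fintype κ] [DecidableEq κ] [Fintype J] [DecidableEq J]
    {M : J → Matrix κ κ ℂ}
    (h1 : ∀ j, (M j).PosSemidef) (h2 : (1 - ∑ j, M j).PosSemidef) (j : J)
    {ρ : Matrix κ κ ℂ} (hρ : IsDensity ρ) : 0 ≤ 1 - (M j * ρ).trace.re := by
  have e : 1 - M j = (1 - ∑ j, M j) + ∑ i ∈ Finset.univ.erase j, M i := by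
    rw [← Finset.add_sum_erase _ _ (Finset.mem_univ j)]; abel
  have hp : (1 - M j).PosSemidef := by
    rw [e]; exact h2.add (Matrix.posSemidef_sum _ fun l _ => h1 _)
  have := trace_mul_nonneg hp hρ.1
  rw [sub_mul, one_mul, Matrix.trace_sub, hρ.2] at this
  simpa using this

lemma sum_fiber {X : Type*} [Fintype X] (f : X → K) (h : X → ℝ) :
    ∑ b, ∑ e, (if f e = b then h e else 0) = ∑ e, h e := by
  rw [Finset.sum_comm]; simp

end

/-- **Main security theorem (Theorem 2).** If the Holevo capacity of Bob's effective
channel exceeds Eve's single-copy accessible information,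
`C(Θ_B ∘ ξ) > C₁(Θ_E ∘ ξ)`, then for all `α, β ∈ (0,1)` and all sufficiently
large `n` there exist a random coder `F` and a POVM `MB` for Bob such that for
every factorized-with-postprocessing attack of Eve (individual POVMs `Mi` with
outcomes in `E` and an arbitrary post-processing `f : Eⁿ → K`):
`Pr[K_A = K_B] ≥ α` and `I(K_A; K_E) ≤ 1 - β`. -/
theorem qkd_security
    {K A E : Type*} [Fintype K] [Fintype A] [Fintype E]
    [DecidableEq K] [Nonempty A]
    (hK : 2 ≤ Fintype.card K) {dA dB dE : ℕ}
    (Θ : Matrix (Fin dA) (Fin dA) ℂ →ₗ[ℂ] Matrix (Fin dB × Fin dE) (Fin dB × Fin dE) ℂ)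
    (hΘ : IsCPTP Θ)
    (ξ : A → Matrix (Fin dA) (Fin dA) ℂ) (hξ : ∀ a, IsDensity (ξ a))
    (hgap : sSup (accInfoSet (fun a => ptraceB (Θ (ξ a)))) <
      sSup (holevoSet (fun a => ptraceE (Θ (ξ a))))) :
    ∀ α β : ℝ, α ∈ Set.Ioo (0 : ℝ) 1 → β ∈ Set.Ioo (0 : ℝ) 1 →
      ∃ N : ℕ, ∀ n, N ≤ n →
        ∃ (F : K → (Fin n → A) → ℝ)
          (MB : K → Matrix (Fin n → Fin dB) (Fin n → Fin dB) ℂ),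
          IsChannel F ∧ IsPOVM MB ∧
          ∀ (Mi : Fin n → E → Matrix (Fin dE) (Fin dE) ℂ)
            (f : (Fin n → E) → K), (∀ i, IsPOVM (Mi i)) →
            (α ≤ ∑ k, ∑ kE, qkdJoint Θ ξ F MB Mi f k k kE) ∧
            miJoint (fun k kE => ∑ kB, qkdJoint Θ ξ F MB Mi f k kB kE) ≤ 1 - β := by
  intro α β hα hβ
  classical
  have hρB : ∀ a, IsDensity (ptraceE (Θ (ξ a))) := fun a => ptraceE_density (cptp_density hΘ (hξ a))
  have hρE : ∀ a, IsDensity (ptraceB (Θ (ξ a))) := fun a => ptraceB_density (cptp_density hΘ (hξ a))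
  set ρB := fun a => ptraceE (Θ (ξ a)) with hρBd
  set ρE := fun a => ptraceB (Θ (ξ a)) with hρEd
  have hne : (holevoSet ρB).Nonempty := by
    obtain ⟨a0⟩ := ‹Nonempty A›
    refine ⟨_, fun a => if a = a0 then 1 else 0, ⟨fun a => ?_, by simp⟩, rfl⟩
    dsimp only
    split_ifs <;> norm_num
  obtain ⟨_, ⟨P, hP, rfl⟩, hlt⟩ := exists_lt_of_lt_csSup hne hgap
  set c0 := sSup (accInfoSet ρE) with hc0
  have hc0n : 0 ≤ c0 := acc_nonneg hρE hP
  set c := c0 * Real.log 2 with hc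
  set χ := holevo P ρB * Real.log 2 with hχ
  have hcn : 0 ≤ c := mul_nonneg hc0n log2_pos.le
  have hcχ : c < χ := mul_lt_mul_of_pos_right hlt log2_pos
  set Δ := χ - c with hΔ
  have hΔp : 0 < Δ := sub_pos.2 hcχ
  have hKp : (0 : ℝ) < Fintype.card K := by
    have : 0 < Fintype.card K := by omega
    exact_mod_cast this
  have : Nonempty K := Fintype.card_pos_iff.1 (by omega)
  obtain ⟨k0⟩ := ‹Nonempty K›
  set κ := (Fintype.card K : ℝ) with hκ
  set 𝒱 : Set (A → E → ℝ) :=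
    {V | ∃ M : E → Matrix (Fin dE) (Fin dE) ℂ, IsPOVM M ∧ V = fun a e => measProb M (ρE a) e}
  have h𝒱 : ∀ V ∈ 𝒱, IsChannel V := by
    rintro _ ⟨M, hM, rfl⟩; exact measProb_channel hM hρE
  have h𝒱c : ∀ V ∈ 𝒱, chanMI P V * Real.log 2 ≤ c := by
    rintro _ ⟨M, hM, rfl⟩
    exact mul_le_mul_of_nonneg_right (chanMI_le_acc hP hM hρE) log2_pos.le
  obtain ⟨ε, hε, hε1, hε2⟩ : ∃ ε : ℝ, 0 < ε ∧ κ * ε ≤ 1 / 4 ∧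
      2 * κ * ε ≤ (1 - β) * Real.log 2 := by
    have hb : 0 < (1 - β) * Real.log 2 := mul_pos (by linarith [hβ.2]) log2_pos
    refine ⟨min (1 / 4 / κ) ((1 - β) * Real.log 2 / (2 * κ)), by positivity, ?_, ?_⟩
    · rw [mul_comm, ← le_div_iff₀ hKp]; exact min_le_left _ _
    · rw [mul_comm, ← le_div_iff₀ (by positivity)]; exact min_le_right _ _
  obtain ⟨C, hC, hBob⟩ := bob_exp hP hρB
  have hη : 0 < (1 - α) / 8 := by linarith [hα.2]
  have hev := (cover_eventually hP 𝒱 h𝒱 (δ := Δ / 4) (by positivity) hε h𝒱c).and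
    ((bob_limit C (Δ / 8) ((1 - α) / 8) (2 * κ) (Δ / 4) (by positivity) hη).and
      (Filter.eventually_gt_atTop 0))
  obtain ⟨N, hN⟩ := Filter.eventually_atTop.1 hev
  refine ⟨N, fun n hn => ?_⟩
  obtain ⟨hcov, hlim, hn0⟩ := hN n hn
  set R := c + 2 * (Δ / 4) with hR
  have hRn : 0 ≤ R := by positivity
  set L := ⌈Real.exp (n * R)⌉₊ with hLd
  have hL1 : Real.exp (n * R) ≤ L := Nat.le_ceil _
  have hexp1 : 1 ≤ Real.exp (n * R) := Real.one_le_exp (by positivity)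
  have hL2 : (L : ℝ) ≤ 2 * Real.exp (n * R) := by
    have := Nat.ceil_lt_add_one (Real.exp_pos (n * R)).le
    linarith
  have hLp : (0 : ℝ) < L := by linarith
  have hLp' : 0 < L := by exact_mod_cast hLp
  obtain ⟨M, hM1, hM2, hM3⟩ := hBob n hn0 (Δ / 8) (by positivity) (K × Fin L)
  set w := pw (fun _ : K × Fin L => pw fun _ : Fin n => P) with hw
  have hwp : IsProbDist w := pw_isProb fun _ => pw_isProb fun _ => hP
  let S : K → Finset (K × Fin L) := fun k =>
    Finset.univ.map ⟨fun l => (k, l), fun a b h => (Prod.mk.inj h).2⟩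
  have hScard : ∀ k, (S k).card = L := fun k => by simp [S]
  let Bad : K → (K × Fin L → Fin n → A) → Prop := fun k x =>
    ∃ V : Fin n → A → E → ℝ, (∀ i, V i ∈ 𝒱) ∧
      ¬ ∑ e, |((S k).card : ℝ)⁻¹ * ∑ j ∈ S k, WV V (x j) e - QV P V e| ≤ ε
  have hbad : ∀ k, PR w (Bad k) ≤ ε := fun k =>
    hcov (K × Fin L) (S k) (by rw [hScard]; exact hL1)
  have hbadAll : PR w (fun x => ∃ k, Bad k x) ≤ 1 / 4 :=
    (PR_exists hwp.1 Bad hbad).trans hε1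
  let g : (K × Fin L → Fin n → A) → ℝ := fun x =>
    (κ * L)⁻¹ * ∑ j, (1 - (M x j * tensPow ρB (x j)).trace.re)
  have hκL : 0 < κ * L := mul_pos hKp hLp
  have hg : ∀ x, 0 ≤ g x := fun x => mul_nonneg (inv_nonneg.2 hκL.le)
    (Finset.sum_nonneg fun j _ => sub_prob (hM1 x) (hM2 x) j (tensPow_isDensity hρB _))
  have hcardJ : (Fintype.card (K × Fin L) : ℝ) = κ * L := by simp [hκ]
  have hgexp : ∑ x, w x * g x ≤ (1 - α) / 4 := by
    have e : ∑ x, w x * g x = (κ * L)⁻¹ * ∑ j, ∑ x, w x *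
        (1 - (M x j * tensPow ρB (x j)).trace.re) := by
      rw [Finset.sum_comm, Finset.mul_sum]
      refine Finset.sum_congr rfl fun x _ => ?_
      simp only [g]
      rw [← Finset.mul_sum]; ring
    have hterm : ∀ j, ∑ x, w x * (1 - (M x j * tensPow ρB (x j)).trace.re) ≤ (1 - α) / 4 := by
      intro j
      refine (hM3 ((1 - α) / 8) hη j).trans ?_
      have h2 : (Fintype.card (K × Fin L) : ℝ) * Real.exp (-(n * (χ - 2 * (Δ / 8)))) ≤
          2 * κ * Real.exp (-(n * (Δ / 4))) := by
        rw [hcardJ]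
        have e1 : Real.exp (-(n * (Δ / 4))) =
            Real.exp (n * R) * Real.exp (-(n * (χ - 2 * (Δ / 8)))) := by
          rw [← Real.exp_add]; congr 1
          have : χ = c + Δ := by rw [hΔ]; ring
          rw [this, hR]; ring
        rw [e1]
        have := mul_le_mul_of_nonneg_right (mul_le_mul_of_nonneg_left hL2 hKp.le)
          (Real.exp_pos (-(n * (χ - 2 * (Δ / 8))))).le
        linarith
      have h3 : 0 ≤ 1 / ((1 - α) / 8) := by positivity
      have h4 := mul_le_mul_of_nonneg_left h2 h3
      have h5 := hlim.le
      rw [mul_add] at h5 ⊢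
      linarith
    rw [e]
    calc _ ≤ (κ * L)⁻¹ * ∑ j : K × Fin L, (1 - α) / 4 :=
          mul_le_mul_of_nonneg_left (Finset.sum_le_sum fun j _ => hterm j) (inv_nonneg.2 hκL.le)
      _ = (1 - α) / 4 := by
          rw [Finset.sum_const, Finset.card_univ, nsmul_eq_mul, hcardJ, ← mul_assoc,
            inv_mul_cancel₀ hκL.ne', one_mul]
  have h1α : 0 < 1 - α := by linarith [hα.2]
  obtain ⟨x, hx1, hx2⟩ := exists_of_exp_lt hwp (B := fun x => ∃ k, Bad k x) hg h1α (by
    have : (∑ x, w x * g x) / (1 - α) ≤ 1 / 4 := by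
      rw [div_le_iff₀ h1α]; linarith
    linarith)
  have hPOVM := bobM_povm (hM1 x) (hM2 x) k0
  refine ⟨coder x, bobM (M x) k0, coder_channel hLp' x, hPOVM, ?_⟩
  intro Mi f hMi
  refine ⟨?_, ?_⟩
  · simp_rw [qkdJoint_bob Θ ξ (coder x) (bobM (M x) k0) Mi f hMi]
    simp_rw [coder_sum]
    have e : g x = 1 - κ⁻¹ * ∑ k, (L : ℝ)⁻¹ * ∑ l,
        (M x (k, l) * tensPow ρB (x (k, l))).trace.re := by
      simp only [g]
      rw [Finset.sum_sub_distrib, Finset.sum_const, Finset.card_univ, nsmul_eq_mul, hcardJ, mul_one,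
        mul_sub, inv_mul_cancel₀ hκL.ne', ← Finset.mul_sum, Fintype.sum_prod_type, mul_inv,
        mul_assoc]
    rw [← Finset.mul_sum]
    have h1 : κ⁻¹ * ∑ k, (L : ℝ)⁻¹ * ∑ l, (M x (k, l) * tensPow ρB (x (k, l))).trace.re ≤
        κ⁻¹ * ∑ k, (L : ℝ)⁻¹ * ∑ l, (bobM (M x) k0 k * tensPow ρB (x (k, l))).trace.re := by
      refine mul_le_mul_of_nonneg_left (Finset.sum_le_sum fun k _ => ?_) (inv_nonneg.2 hKp.le)
      refine mul_le_mul_of_nonneg_left (Finset.sum_le_sum fun l _ => ?_) (inv_nonneg.2 hLp.le)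
      exact bobM_ge (hM1 x) (hM2 x) k0 k l (tensPow_isDensity hρB _).1
    linarith
  · simp_rw [qkdJoint_eve Θ ξ (coder x) (bobM (M x) k0) Mi f hPOVM hMi hρE]
    simp_rw [coder_sum]
    let V : Fin n → A → E → ℝ := fun i a e => measProb (Mi i) (ρE a) e
    have hV : ∀ i, V i ∈ 𝒱 := fun i => ⟨Mi i, hMi i, rfl⟩
    have hVc : ∀ i, IsChannel (V i) := fun i => h𝒱 _ (hV i)
    let H : K → (Fin n → E) → ℝ := fun k e => (L : ℝ)⁻¹ * ∑ l, WV V (x (k, l)) e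
    let G : K → K → ℝ := fun k b => ∑ e, if f e = b then H k e else 0
    let D : K → ℝ := fun b => ∑ e, if f e = b then QV P V e else 0
    have hHn : ∀ k e, 0 ≤ H k e := fun k e => mul_nonneg (inv_nonneg.2 hLp.le)
      (Finset.sum_nonneg fun l _ => WV_nonneg hVc _ _)
    have hHs : ∀ k, ∑ e, H k e = 1 := by
      intro k
      simp only [H]
      rw [← Finset.mul_sum, Finset.sum_comm]
      simp only [WV_sum hVc]
      simp [hLp.ne']
    have hG : IsChannel G := by
      refine ⟨fun k b => Finset.sum_nonneg fun e _ => ?_, fun k => ?_⟩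
      · split_ifs
        · exact hHn k e
        · exact le_rfl
      · simp only [G]; rw [sum_fiber, hHs]
    have hclose : ∀ k, ∑ b, |G k b - D b| ≤ ε := by
      intro k
      have h0 : ∑ e, |H k e - QV P V e| ≤ ε := by
        by_contra hcon
        refine hx1 ⟨k, V, hV, ?_⟩
        have hs : ∀ e, ∑ j ∈ S k, WV V (x j) e = ∑ l, WV V (x (k, l)) e := by
          intro e
          simp only [S]
          rw [Finset.sum_map]
          rfl
        simp only [hs, hScard]
        exact hcon
      refine le_trans ?_ h0
      rw [← sum_fiber f (fun e => |H k e - QV P V e|)]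
      refine Finset.sum_le_sum fun b _ => ?_
      simp only [G, D]
      rw [← Finset.sum_sub_distrib]
      refine (Finset.abs_sum_le_sum_abs _ _).trans (Finset.sum_le_sum fun e _ => ?_)
      split_ifs <;> simp
    have hmi := miJoint_le_of_close hG D hclose
    have e : (fun k b => κ⁻¹ * G k b) = (fun (k : K) (kE : K) => κ⁻¹ * ((L : ℝ)⁻¹ *
        ∑ l, ∑ e : Fin n → E, if f e = kE then
          WV (fun i a e => measProb (Mi i) (ptraceB (Θ (ξ a))) e) (x (k, l)) e else 0)) := by
      funext k b
      congr 1
      simp only [G, H]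
      rw [Finset.sum_comm, Finset.mul_sum]
      refine Finset.sum_congr rfl fun e _ => ?_
      by_cases he : f e = b
      · simp only [he, if_true]; rfl
      · simp [he]
    rw [← e]
    have := hmi.trans hε2
    exact le_of_mul_le_mul_right this log2_pos

end QKD
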